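/- Let G = (ℝⁿ, ∘, {δ_λ}) be a homogeneous Lie group with right-invariant homogeneous metric ρ, Haar (Lebesgue) measure μ, and homogeneous dimension 𝐝, and let d ≥ 1. Let 𝒬 be the collection of unital (Q(0) = 0) real-valued Leibman polynomial maps on G of degree at most d. Then there exist constants ε > 0 and C > 0 such that for every ball B of radius R in G, every Lipschitz function φ: G → ℂ supported in B, and all f, g ∈ 𝒬: |∫_B e((f−g)(x)) φ(x) dμ(x)| ≤ C R^𝐝 ‖φ‖_{C^{0,1}(B)} (1 + d_B(f,g))^{−ε}. -/

import Mathlib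

open MeasureTheory Complex Filter Set
open scoped ENNReal NNReal

noncomputable section

/-- `e(t) = e^{it}`. -/
def expi (t : ℝ) : ℂ := Complex.exp (t * Complex.I)

/-- The `r`-variation seminorm (valued in `ℝ≥0∞`) of `a : ℝ → ℂ` along the index set `I`. -/
def vNorm (r : ℝ) (I : Set ℝ) (a : ℝ → ℂ) : ℝ≥0∞ :=
  ⨆ (N : ℕ) (t : ℕ → ℝ) (_ : ∀ n, n ≤ N → t n ∈ I) (_ : ∀ n, n < N → t n < t (n + 1)),
    (∑ n ∈ Finset.range N, (‖a (t (n + 1)) - a (t n)‖₊ : ℝ≥0∞) ^ r) ^ (1 / r)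

/-- The family of dilations `δ_λ(x)_i = λ^{σ_i} x_i`. -/
def dil {n : ℕ} (σ : Fin n → ℝ) (l : ℝ) (x : Fin n → ℝ) : Fin n → ℝ :=
  fun i => l ^ σ i * x i

/-- A homogeneous Lie group structure on `ℝⁿ`: a polynomial group law `x ∘ y = x + y + P(x,y)`
with identity `0`, together with a family of automorphic dilations with exponents
`1 ≤ σ₁ ≤ … ≤ σₙ`, and a parameter `ε > 0` defining the homogeneous quasi-metric. -/
structure HomLieGroup (n : ℕ) where
  mul : (Fin n → ℝ) → (Fin n → ℝ) → Fin n → ℝ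
  inv : (Fin n → ℝ) → Fin n → ℝ
  mul_assoc : ∀ x y z, mul (mul x y) z = mul x (mul y z)
  zero_mul : ∀ x, mul 0 x = x
  mul_zero : ∀ x, mul x 0 = x
  inv_mul : ∀ x, mul (inv x) x = 0
  mul_inv : ∀ x, mul x (inv x) = 0
  mul_isPoly : ∃ p : Fin n → MvPolynomial (Fin n ⊕ Fin n) ℝ,
    ∀ x y i, mul x y i = MvPolynomial.eval (Sum.elim x y) (p i)
  σ : Fin n → ℝ
  one_le_σ : ∀ i, 1 ≤ σ i
  σ_mono : Monotone σ
  dil_mul : ∀ l : ℝ, 0 < l → ∀ x y, dil σ l (mul x y) = mul (dil σ l x) (dil σ l y)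
  eps : ℝ
  eps_pos : 0 < eps

namespace HomLieGroup

variable {n : ℕ} (G : HomLieGroup n)

/-- The homogeneous dimension `𝐝 = σ₁ + … + σₙ`. -/
def homDim : ℝ := ∑ i, G.σ i

/-- The homogeneous distance `ρ(x,y) = inf {λ > 0 : δ_{λ⁻¹}(x ∘ y⁻¹) ∈ U_ε}`. -/
def rho (x y : Fin n → ℝ) : ℝ :=
  sInf {l : ℝ | 0 < l ∧ ∑ j, (dil G.σ l⁻¹ (G.mul x (G.inv y)) j) ^ 2 < G.eps ^ 2}

/-- The assertion that `ρ` is a metric (the paper's choice of `ε` guarantees this;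
right-invariance is automatic from the definition). -/
def IsMetric : Prop :=
  (∀ x y, 0 ≤ G.rho x y) ∧ (∀ x y, G.rho x y = 0 ↔ x = y) ∧
    (∀ x y, G.rho x y = G.rho y x) ∧ (∀ x y z, G.rho x z ≤ G.rho x y + G.rho y z)

/-- The `ρ`-ball of radius `R` around `z`. -/
def ball (z : Fin n → ℝ) (R : ℝ) : Set (Fin n → ℝ) := {x | G.rho z x < R}

/-- Real-valued Leibman polynomial maps of degree at most `d` on `G`. -/
def IsLeibman : ℕ → ((Fin n → ℝ) → ℝ) → Prop
  | 0, f => ∀ g g', f (G.mul g' (G.inv g)) - f g' = 0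
  | d + 1, f => ∀ g, IsLeibman d fun g' => f (G.mul g' (G.inv g)) - f g'

end HomLieGroup

/-- A measure-preserving action of the homogeneous Lie group `G` on `(X, ν)`. -/
def IsMPAction {n : ℕ} (G : HomLieGroup n) {X : Type*} [MeasurableSpace X] (ν : Measure X)
    (T : (Fin n → ℝ) → X → X) : Prop :=
  Measurable (fun q : (Fin n → ℝ) × X => T q.1 q.2) ∧
    (∀ g h x, T (G.mul g h) x = T g (T h x)) ∧ (∀ x, T 0 x = x) ∧
    (∀ g, MeasurePreserving (T g) ν ν)

def dB {Y : Type*} (B : Set Y) (f g : Y → ℝ) : ℝ :=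
  sSup ((fun q : Y × Y => |f q.1 - f q.2 - g q.1 + g q.2|) '' (B ×ˢ B))

def c01G {n : ℕ} (G : HomLieGroup n) (z : Fin n → ℝ) (R : ℝ)
    (φ : (Fin n → ℝ) → ℂ) : ℝ :=
  sSup ((fun x => ‖φ x‖) '' G.ball z R) +
    R * sSup ((fun q : (Fin n → ℝ) × (Fin n → ℝ) => ‖φ q.1 - φ q.2‖ / G.rho q.1 q.2) ''
      ((G.ball z R ×ˢ G.ball z R) ∩ {q | q.1 ≠ q.2}))

/-! ### One-dimensional oscillatory integrals with polynomial phase -/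

lemma expi_norm (t : ℝ) : ‖expi t‖ = 1 := by
  unfold expi; exact Complex.norm_exp_ofReal_mul_I t

lemma expi_cont : Continuous expi := by unfold expi; fun_prop

lemma expi_hasDerivAt {f : ℝ → ℝ} {f' t : ℝ} (h : HasDerivAt f f' t) :
    HasDerivAt (fun t => expi (f t)) (expi (f t) * (f' * Complex.I)) t := by
  unfold expi
  exact ((h.ofReal_comp).mul_const Complex.I).cexp

lemma lag_eq {m : ℕ} (Q : Polynomial ℝ) (hQ : Q.natDegree ≤ m) (v : Fin (m+1) → ℝ)
    (hv : Function.Injective v) :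
    Q = ∑ i, Polynomial.C (Q.eval (v i)) * Lagrange.basis Finset.univ v i := by
  have h := Lagrange.eq_interpolate (s := Finset.univ) (v := v) (f := Q) (hv.injOn) (by
    simp only [Finset.card_univ, Fintype.card_fin]
    refine lt_of_le_of_lt Polynomial.degree_le_natDegree ?_
    exact_mod_cast Nat.lt_succ_of_le hQ)
  rw [Lagrange.interpolate_apply] at h
  exact h

lemma lag_sep {m : ℕ} (Q : Polynomial ℝ) (hQ : Q.natDegree ≤ m) (v : Fin (m+1) → ℝ) (q s : ℝ)
    (hq : 0 < q) (hv : ∀ i, v i ∈ Icc (0:ℝ) 1) (hsep : ∀ i j, i ≠ j → 1 / q ≤ |v i - v j|)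
    (hs : ∀ i, |Q.eval (v i)| ≤ s) (t : ℝ) (ht : t ∈ Icc (0:ℝ) 1) :
    |Q.eval t| ≤ (m+1) * s * q ^ m := by
  have hinj : Function.Injective v := by
    intro i j hij
    by_contra hne
    have := hsep i j hne
    rw [hij, sub_self, abs_zero] at this
    have : 0 < 1 / q := by positivity
    linarith
  have hs0 : 0 ≤ s := le_trans (abs_nonneg _) (hs 0)
  have hb : ∀ i, |(Lagrange.basis Finset.univ v i).eval t| ≤ q ^ m := by
    intro i
    unfold Lagrange.basis
    rw [Polynomial.eval_prod, Finset.abs_prod]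
    calc _ ≤ ∏ j ∈ Finset.univ.erase i, q := by
          apply Finset.prod_le_prod
          · intros; exact abs_nonneg _
          · intro j hj
            have hne : i ≠ j := (Finset.ne_of_mem_erase hj).symm
            have h1 := hsep i j hne
            unfold Lagrange.basisDivisor
            simp only [Polynomial.eval_mul, Polynomial.eval_C, Polynomial.eval_sub,
              Polynomial.eval_X]
            rw [abs_mul, abs_inv]
            have h2 : |t - v j| ≤ 1 := by
              have := hv j
              rw [abs_le]; constructor <;> linarith [ht.1, ht.2, this.1, this.2]
            have h3 : |v i - v j|⁻¹ ≤ q := by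
              have := inv_anti₀ (by positivity) h1
              simpa using this
            calc _ ≤ q * 1 := by gcongr
              _ = q := mul_one q
      _ = q ^ m := by simp
  have hE : Q.eval t = ∑ i, Q.eval (v i) * (Lagrange.basis Finset.univ v i).eval t := by
    conv_lhs => rw [lag_eq Q hQ v hinj]
    simp [Polynomial.eval_finsetSum]
  rw [hE]
  calc _ ≤ ∑ i, |Q.eval (v i) * (Lagrange.basis Finset.univ v i).eval t| :=
        Finset.abs_sum_le_sum_abs _ _
    _ ≤ ∑ _i : Fin (m+1), s * q ^ m := by
        apply Finset.sum_le_sum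
        intro i _
        rw [abs_mul]
        gcongr
        · exact hs i
        · exact hb i
    _ = _ := by simp; ring

lemma poly_bdd (R : Polynomial ℝ) : ∃ c : ℝ, ∀ t ∈ Icc (0:ℝ) 1, |R.eval t| ≤ c := by
  obtain ⟨c, hc⟩ := isCompact_Icc.exists_bound_of_continuousOn (s := Icc (0:ℝ) 1)
    (f := fun t => R.eval t) (Polynomial.continuous _).continuousOn
  exact ⟨c, fun t ht => by simpa using hc t ht⟩

lemma exists_nodes (m : ℕ) :
    ∃ v : Fin (m+1) → ℝ, Function.Injective v ∧ ∀ i, v i ∈ Icc (0:ℝ) 1 := by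
  have h0 : ((m:ℝ)+1) ≠ 0 := by positivity
  refine ⟨fun i => ((i : ℕ) : ℝ) / ((m:ℝ)+1), ?_, ?_⟩
  · intro i j hij
    have h1 : ((i:ℕ):ℝ) = ((j:ℕ) : ℝ) := by
      have h2 : ((i : ℕ) : ℝ) / ((m:ℝ)+1) = ((j : ℕ) : ℝ) / ((m:ℝ)+1) := hij
      field_simp at h2
      exact h2
    exact Fin.ext (Nat.cast_injective h1)
  · intro i
    have h2 : ((i:ℕ):ℝ) ≤ (m:ℝ) + 1 := by exact_mod_cast i.2.le
    exact ⟨by positivity, (div_le_one (by positivity)).mpr h2⟩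

lemma markov_poly (m : ℕ) : ∃ C : ℝ, 0 < C ∧ ∀ Q : Polynomial ℝ, Q.natDegree ≤ m → ∀ M : ℝ,
    (∀ t ∈ Icc (0:ℝ) 1, |Q.eval t| ≤ M) → ∀ t ∈ Icc (0:ℝ) 1, |Q.derivative.eval t| ≤ C * M := by
  obtain ⟨v, hinj, hv⟩ := exists_nodes m
  obtain ⟨c, hc⟩ : ∃ c : Fin (m+1) → ℝ, ∀ i, ∀ t ∈ Icc (0:ℝ) 1,
      |(Lagrange.basis Finset.univ v i).derivative.eval t| ≤ c i :=
    ⟨fun i => (poly_bdd _).choose, fun i => (poly_bdd _).choose_spec⟩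
  refine ⟨(∑ i, |c i|) + 1, add_pos_of_nonneg_of_pos (Finset.sum_nonneg fun i _ => abs_nonneg _) one_pos, ?_⟩
  intro Q hQ M hM t ht
  have hM0 : 0 ≤ M := le_trans (abs_nonneg _) (hM t ht)
  have hE : Q.derivative.eval t
      = ∑ i, Q.eval (v i) * (Lagrange.basis Finset.univ v i).derivative.eval t := by
    have h := congrArg (fun R : Polynomial ℝ => R.derivative.eval t) (lag_eq Q hQ v hinj)
    simp only [Polynomial.derivative_sum, Polynomial.derivative_C_mul, Polynomial.eval_finsetSum,
      Polynomial.eval_mul, Polynomial.eval_C] at h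
    exact h
  rw [hE]
  have h1 : |∑ i, Q.eval (v i) * (Lagrange.basis Finset.univ v i).derivative.eval t|
      ≤ ∑ i, M * |c i| := by
    refine (Finset.abs_sum_le_sum_abs _ _).trans (Finset.sum_le_sum ?_)
    intro i _
    rw [abs_mul]
    exact mul_le_mul (hM _ (hv i)) ((hc i t ht).trans (le_abs_self _)) (abs_nonneg _) hM0
  refine h1.trans ?_
  rw [← Finset.mul_sum, add_mul, one_mul, mul_comm M]
  exact le_add_of_nonneg_right hM0

lemma osc_good (P : Polynomial ℝ) (a b s N : ℝ) (hab : a ≤ b) (hs : 0 < s)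
    (h1 : ∀ t ∈ Icc a b, s ≤ |P.derivative.eval t|)
    (h2 : ∀ t ∈ Icc a b, |P.derivative.derivative.eval t| ≤ N) :
    ‖∫ t in a..b, expi (P.eval t)‖ ≤ 2 / s + N / s ^ 2 * (b - a) := by
  have hne : ∀ t ∈ Icc a b, P.derivative.eval t ≠ 0 := fun t ht h0 => by
    have := h1 t ht; rw [h0, abs_zero] at this; linarith
  set u : ℝ → ℂ := fun t => (((P.derivative.eval t)⁻¹ : ℝ) : ℂ) with hu
  set u' : ℝ → ℂ := fun t =>
    ((-(P.derivative.derivative.eval t) / (P.derivative.eval t)^2 : ℝ) : ℂ) with hu'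
  set w : ℝ → ℂ := fun t => -Complex.I * expi (P.eval t) with hw
  set w' : ℝ → ℂ := fun t => -Complex.I * (expi (P.eval t) * ((P.derivative.eval t : ℝ) * Complex.I))
    with hw'
  have hmem : ∀ t ∈ uIcc a b, t ∈ Icc a b := by intro t ht; rwa [uIcc_of_le hab] at ht
  have hexp : Continuous fun t => expi (P.eval t) := expi_cont.comp (Polynomial.continuous _)
  have hc' : ContinuousOn u' (uIcc a b) := by
    rw [hu']
    apply Complex.continuous_ofReal.comp_continuousOn
    apply ContinuousOn.div
    · exact (Polynomial.continuous _).neg.continuousOn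
    · exact ((Polynomial.continuous _).pow 2).continuousOn
    · intro t ht; exact pow_ne_zero _ (hne t (hmem t ht))
  have hcw' : Continuous w' := by
    rw [hw']
    have : Continuous fun t => P.derivative.eval t := Polynomial.continuous _
    fun_prop
  have key := intervalIntegral.integral_mul_deriv_eq_deriv_mul (a := a) (b := b) (u := u) (v := w)
    (u' := u') (v' := w')
    (fun t ht => ((Polynomial.hasDerivAt (P.derivative) t).inv (hne t (hmem t ht))).ofReal_comp)
    (fun t ht => (expi_hasDerivAt (Polynomial.hasDerivAt P t)).const_mul _)
    hc'.intervalIntegrable (hcw'.intervalIntegrable _ _)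
  have hEq : ∫ t in a..b, expi (P.eval t) = ∫ t in a..b, u t * w' t := by
    apply intervalIntegral.integral_congr
    intro t ht
    have h0 : ((P.derivative.eval t : ℝ) : ℂ) ≠ 0 := by exact_mod_cast hne t (hmem t ht)
    simp only [hu, hw', Complex.ofReal_inv]
    field_simp
    rw [Complex.I_sq]; ring
  have hw1 : ∀ t, ‖w t‖ = 1 := by intro t; simp [hw, expi_norm]
  have hu1 : ∀ t ∈ Icc a b, ‖u t‖ ≤ 1 / s := by
    intro t ht
    simp only [hu, Complex.norm_real, Real.norm_eq_abs, abs_inv, one_div]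
    exact inv_anti₀ hs (h1 t ht)
  have hu'1 : ∀ t ∈ Icc a b, ‖u' t‖ ≤ N / s ^ 2 := by
    intro t ht
    simp only [hu', Complex.norm_real, Real.norm_eq_abs, abs_div, abs_neg, abs_pow]
    have hN : 0 ≤ N := le_trans (abs_nonneg _) (h2 t ht)
    have := h1 t ht
    have := h2 t ht
    gcongr
  rw [hEq, key]
  have hI : ‖∫ t in a..b, u' t * w t‖ ≤ N / s ^ 2 * |b - a| := by
    apply intervalIntegral.norm_integral_le_of_norm_le_const
    intro t ht
    rw [uIoc_of_le hab] at ht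
    rw [norm_mul, hw1, mul_one]
    exact hu'1 t ⟨ht.1.le, ht.2⟩
  rw [abs_of_nonneg (by linarith)] at hI
  have ha := hu1 a ⟨le_refl _, hab⟩
  have hb := hu1 b ⟨hab, le_refl _⟩
  calc _ ≤ ‖u b * w b - u a * w a‖ + ‖∫ t in a..b, u' t * w t‖ := norm_sub_le _ _
    _ ≤ (‖u b * w b‖ + ‖u a * w a‖) + ‖∫ t in a..b, u' t * w t‖ := by gcongr; exact norm_sub_le _ _
    _ ≤ (1 / s + 1 / s) + N / s ^ 2 * (b - a) := by
        have hm : ∀ t, ‖u t * w t‖ = ‖u t‖ := fun t => by rw [norm_mul (u t) (w t), hw1, mul_one]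
        rw [hm, hm]; gcongr
    _ = _ := by ring

/-- the number of bad intervals is small -/
lemma bad_card {m : ℕ} (Q : Polynomial ℝ) (hQ : Q.natDegree ≤ m) (q : ℕ) (hq : 0 < q) (s : ℝ)
    (tm : ℝ) (htm : tm ∈ Icc (0:ℝ) 1) (hlarge : (m+1) * s * q ^ m < |Q.eval tm|)
    (Bd : Finset ℕ) (hBd : ∀ k ∈ Bd, k < q ^ 2 ∧
      ∃ t ∈ Icc ((k:ℝ) / q ^ 2) ((k+1 : ℝ) / q ^ 2), |Q.eval t| ≤ s) :
    Bd.card < (m+1) * (q+1) := by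
  by_contra hcon
  push Not at hcon
  set e := Bd.orderEmbOfFin rfl with he
  set idx : Fin (m+1) → Fin Bd.card := fun i => ⟨i * (q+1), by
    have : (i:ℕ) * (q+1) < (m+1) * (q+1) := Nat.mul_lt_mul_of_pos_right i.2 (by omega)
    omega⟩ with hidx
  have hstep : ∀ (a b : Fin Bd.card), a ≤ b → (e a : ℕ) + (b - a : ℕ) ≤ e b := by
    intro a b hab
    obtain ⟨a, ha⟩ := a
    obtain ⟨b, hb⟩ := b
    simp only [Fin.mk_le_mk] at hab
    obtain ⟨c, rfl⟩ := Nat.exists_eq_add_of_le hab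
    induction c with
    | zero => simp
    | succ c ih =>
      have h1 := ih (by omega) (by omega)
      have h2 : e ⟨a + c, by omega⟩ < e ⟨a + (c+1), hb⟩ := by
        apply e.strictMono; simp
      simp only at h1 ⊢
      omega
  have hmem : ∀ i, e (idx i) ∈ Bd := fun i => Finset.orderEmbOfFin_mem _ _ _
  choose t ht hts using fun i => (hBd _ (hmem i)).2
  have hk := fun i => (hBd _ (hmem i)).1
  have hq0 : (0:ℝ) < q := by exact_mod_cast hq
  have hsep' : ∀ i j, i < j → 1 / (q:ℝ) ≤ t j - t i := by
    intro i j hij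
    have h1 := hstep (idx i) (idx j) (by
      simp only [hidx, Fin.mk_le_mk]
      exact Nat.mul_le_mul_right _ hij.le)
    have h2 : (i:ℕ) * (q+1) + (q+1) ≤ j * (q+1) := by
      have : (i:ℕ) + 1 ≤ j := hij
      calc _ = ((i:ℕ)+1) * (q+1) := by ring
        _ ≤ _ := Nat.mul_le_mul_right _ this
    simp only [hidx] at h1
    have h3 : (e (idx i) : ℕ) + (q + 1) ≤ e (idx j) := by
      simp only [hidx]; omega
    have h3' : (e (idx i) : ℝ) + (q + 1) ≤ e (idx j) := by exact_mod_cast h3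
    have h4 := (ht i).2
    have h5 := (ht j).1
    have : 1 / (q:ℝ) = q / q ^ 2 := by field_simp
    rw [this]
    have h6 : (q:ℝ) / q ^ 2 + ((e (idx i) : ℝ) + 1) / q ^ 2 ≤ (e (idx j) : ℝ) / q ^ 2 := by
      rw [← add_div]; gcongr; linarith
    linarith
  have := lag_sep Q hQ t q s hq0 (by
      intro i
      refine ⟨le_trans (by positivity) (ht i).1, le_trans (ht i).2 ?_⟩
      rw [div_le_one (by positivity)]
      exact_mod_cast hk i) (by
      intro i j hij
      rcases lt_or_gt_of_ne hij with h | h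
      · rw [abs_sub_comm]; exact (hsep' i j h).trans (le_abs_self _)
      · exact (hsep' j i h).trans (le_abs_self _)) hts tm htm
  linarith

lemma osc_q (m : ℕ) : ∃ C : ℝ, 0 < C ∧ ∀ P : Polynomial ℝ, P.natDegree ≤ m → ∀ M : ℝ,
    (∀ t ∈ Icc (0:ℝ) 1, |P.derivative.eval t| ≤ M) →
    (∃ t ∈ Icc (0:ℝ) 1, |P.derivative.eval t| = M) →
    ∀ q : ℕ, 0 < q → (q:ℝ) ^ (2*m+4) ≤ M →
    ‖∫ t in (0:ℝ)..1, expi (P.eval t)‖ ≤ C / q := by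
  obtain ⟨C1, hC1, hmk⟩ := markov_poly m
  refine ⟨4 * (m+1) + C1 * (4 * (m+1)^2) + 2 * (m+1), by positivity, ?_⟩
  rintro P hP M hM ⟨tm, htm, htM⟩ q hq hqM
  have hq0 : (0:ℝ) < q := by exact_mod_cast hq
  have hq1 : (1:ℝ) ≤ q := by exact_mod_cast hq
  have hM0 : 0 < M := lt_of_lt_of_le (by positivity) hqM
  have hdP : P.derivative.natDegree ≤ m := (Polynomial.natDegree_derivative_le P).trans (by omega)
  have hdd := hmk _ hdP M hM
  set s : ℝ := M / (2 * (m+1) * q ^ m) with hs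
  have hs0 : 0 < s := by positivity
  classical
  set K := q ^ 2 with hK
  set bad : ℕ → Prop := fun k =>
    ∃ t ∈ Icc ((k:ℝ) / q ^ 2) ((k+1 : ℝ) / q ^ 2), |P.derivative.eval t| ≤ s with hbad
  set Bd := (Finset.range K).filter bad with hBd
  have hcard : Bd.card < (m+1) * (q+1) := by
    apply bad_card P.derivative hdP q hq s tm htm
    · rw [htM, hs]
      have : (m+1) * (M / (2 * (m+1) * (q:ℝ) ^ m)) * q ^ m = M / 2 := by field_simp
      rw [this]; linarith
    · intro k hk
      rw [hBd, Finset.mem_filter, Finset.mem_range] at hk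
      exact hk
  set a : ℕ → ℝ := fun k => (k:ℝ) / q ^ 2 with ha
  have hcont : Continuous fun t => expi (P.eval t) := expi_cont.comp (Polynomial.continuous _)
  have hsum := intervalIntegral.sum_integral_adjacent_intervals (f := fun t => expi (P.eval t))
    (μ := volume) (a := a) (n := K) (fun k _ => hcont.intervalIntegrable _ _)
  have ha0 : a 0 = 0 := by simp [ha]
  have haK : a K = 1 := by
    have : (K:ℝ) = q ^ 2 := by rw [hK]; push_cast; rfl
    simp only [ha]; rw [this, div_self (by positivity)]
  rw [ha0, haK] at hsum
  rw [← hsum]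
  have hdiff : ∀ k, a (k+1) - a k = 1 / q ^ 2 := by intro k; simp only [ha]; push_cast; ring
  have hle : ∀ k, a k ≤ a (k+1) := by
    intro k; have := hdiff k; have : 0 < 1 / (q:ℝ)^2 := by positivity
    linarith
  have hbadbd : ∀ k, ‖∫ t in a k..a (k+1), expi (P.eval t)‖ ≤ 1 / q ^ 2 := by
    intro k
    have := intervalIntegral.norm_integral_le_of_norm_le_const (a := a k) (b := a (k+1))
      (f := fun t => expi (P.eval t)) (C := 1) (fun t _ => (expi_norm _).le)
    rw [hdiff, one_mul, abs_of_pos (by positivity)] at this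
    exact this
  have hgood : ∀ k, k < K → ¬ bad k → ‖∫ t in a k..a (k+1), expi (P.eval t)‖ ≤
      2 / s + C1 * M / s ^ 2 * (1 / q ^ 2) := by
    intro k hk hnb
    rw [← hdiff k]
    have hsub : ∀ t ∈ Icc (a k) (a (k+1)), t ∈ Icc (0:ℝ) 1 := by
      intro t ht
      refine ⟨le_trans (by simp only [ha]; positivity) ht.1, ht.2.trans ?_⟩
      simp only [ha]
      rw [div_le_one (by positivity)]
      have : k + 1 ≤ q ^ 2 := hk
      exact_mod_cast this
    apply osc_good P _ _ _ _ (hle k) hs0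
    · intro t ht
      by_contra hlt
      push Not at hlt
      exact hnb ⟨t, by simpa [ha] using ht, hlt.le⟩
    · intro t ht
      exact hdd t (hsub t ht)
  have hterm : ∀ k ∈ Finset.range K, ‖∫ t in a k..a (k+1), expi (P.eval t)‖ ≤
      (2 / s + C1 * M / s ^ 2 * (1 / q ^ 2)) + if bad k then 1 / (q:ℝ)^2 else 0 := by
    intro k hk
    have hp : 0 ≤ 2 / s + C1 * M / s ^ 2 * (1 / (q:ℝ) ^ 2) := by positivity
    by_cases hb : bad k
    · rw [if_pos hb]; linarith [hbadbd k]
    · rw [if_neg hb]; linarith [hgood k (Finset.mem_range.mp hk) hb]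
  calc _ ≤ ∑ k ∈ Finset.range K, ‖∫ t in a k..a (k+1), expi (P.eval t)‖ := norm_sum_le _ _
    _ ≤ _ := Finset.sum_le_sum hterm
    _ = K * (2 / s + C1 * M / s ^ 2 * (1 / q ^ 2)) + Bd.card * (1 / (q:ℝ)^2) := by
        rw [Finset.sum_add_distrib, Finset.sum_const, Finset.card_range, nsmul_eq_mul,
          ← Finset.sum_filter, Finset.sum_const, nsmul_eq_mul]
    _ ≤ K * (2 / s + C1 * M / s ^ 2 * (1 / q ^ 2)) + ((m+1) * (q+1)) * (1 / (q:ℝ)^2) := by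
        gcongr
        exact_mod_cast hcard.le
    _ = 4 * (m+1) * (q ^ (m+2) / M) + C1 * (4 * (m+1)^2) * (q ^ (2*m) / M)
        + (m+1) * ((q+1) / q^2) := by
        rw [hs, hK]; push_cast; field_simp; ring
    _ ≤ 4 * (m+1) * (1 / q) + C1 * (4 * (m+1)^2) * (1 / q) + (m+1) * (2 / q) := by
        gcongr ?_ * ?_ + ?_ * ?_ + ?_ * ?_
        · rw [div_le_div_iff₀ hM0 hq0, one_mul]
          refine le_trans ?_ hqM
          rw [← pow_succ]
          exact pow_le_pow_right₀ hq1 (by omega)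
        · rw [div_le_div_iff₀ hM0 hq0, one_mul]
          refine le_trans ?_ hqM
          rw [← pow_succ]
          exact pow_le_pow_right₀ hq1 (by omega)
        · rw [div_le_div_iff₀ (by positivity) hq0]
          nlinarith
    _ = _ := by ring

/-- Oscillatory integral bound. -/
lemma osc_one (m : ℕ) : ∃ C c : ℝ, 0 < C ∧ 0 < c ∧ ∀ P : Polynomial ℝ, P.natDegree ≤ m →
    ∀ a ∈ Icc (0:ℝ) 1, ∀ b ∈ Icc (0:ℝ) 1,
    ‖∫ t in (0:ℝ)..1, expi (P.eval t)‖ ≤ C * (1 + |P.eval a - P.eval b|) ^ (-c) := by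
  obtain ⟨C, hC, hmain⟩ := osc_q m
  set c : ℝ := 1 / (2*m+4) with hc
  have hc0 : 0 < c := by positivity
  have hc1 : c ≤ 1 := by
    rw [hc, div_le_one (by positivity)]; have : (0:ℝ) ≤ m := by positivity
    linarith
  refine ⟨2 + 4 * C, c, by positivity, hc0, ?_⟩
  intro P hP a ha b hb
  obtain ⟨tm, htm, hmax⟩ := isCompact_Icc.exists_isMaxOn (s := Icc (0:ℝ) 1) ⟨0, by simp⟩
    (f := fun t => |P.derivative.eval t|) (Polynomial.continuous _).abs.continuousOn
  set M := |P.derivative.eval tm| with hM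
  have hMb : ∀ t ∈ Icc (0:ℝ) 1, |P.derivative.eval t| ≤ M := fun t ht => hmax ht
  have hM0 : 0 ≤ M := abs_nonneg _
  have hosc : |P.eval a - P.eval b| ≤ M := by
    have := (convex_Icc (0:ℝ) 1).norm_image_sub_le_of_norm_hasDerivWithin_le
      (f := fun t => P.eval t) (f' := fun t => P.derivative.eval t) (C := M)
      (fun t _ => (Polynomial.hasDerivAt P t).hasDerivWithinAt)
      (fun t ht => by simpa using hMb t ht) hb ha
    simp only [Real.norm_eq_abs] at this
    have h2 : |a - b| ≤ 1 := by rw [abs_le]; constructor <;> linarith [ha.1, ha.2, hb.1, hb.2]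
    nlinarith [abs_nonneg (a-b)]
  have hmono : (1 + M) ^ (-c) ≤ (1 + |P.eval a - P.eval b|) ^ (-c) :=
    Real.rpow_le_rpow_of_nonpos (by positivity) (by linarith) (by linarith)
  refine le_trans ?_ (mul_le_mul_of_nonneg_left hmono (by positivity))
  have htriv : ‖∫ t in (0:ℝ)..1, expi (P.eval t)‖ ≤ 1 := by
    have := intervalIntegral.norm_integral_le_of_norm_le_const (a := 0) (b := 1)
      (f := fun t => expi (P.eval t)) (C := 1) (fun t _ => (expi_norm _).le)
    simpa using this
  have h2c : ∀ x : ℝ, 0 < x → x ≤ 2 → (1:ℝ)/2 ≤ x ^ (-c) := by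
    intro x hx hx2
    calc (1:ℝ)/2 = 2 ^ (-1:ℝ) := by rw [Real.rpow_neg_one]; norm_num
      _ ≤ 2 ^ (-c) := Real.rpow_le_rpow_of_exponent_le (by norm_num) (by linarith)
      _ ≤ x ^ (-c) := Real.rpow_le_rpow_of_nonpos hx hx2 (by linarith)
  rcases lt_or_ge M 1 with hlt | hge
  · have := h2c (1+M) (by linarith) (by linarith)
    nlinarith
  · have hMc : 1 ≤ M ^ c := Real.one_le_rpow hge hc0.le
    set q := ⌊M ^ c⌋₊ with hq
    have hq1 : 1 ≤ q := by rw [hq]; exact Nat.le_floor (by simpa using hMc)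
    have hq1' : (1:ℝ) ≤ q := by exact_mod_cast hq1
    have hqle : (q:ℝ) ≤ M ^ c := Nat.floor_le (by positivity)
    have hqlt : M ^ c < q + 1 := Nat.lt_floor_add_one _
    have hpow : (q:ℝ) ^ (2*m+4) ≤ M := by
      calc (q:ℝ) ^ (2*m+4) ≤ (M ^ c) ^ (2*m+4) := by gcongr
        _ = M := by
          rw [← Real.rpow_natCast, ← Real.rpow_mul hM0, hc]
          push_cast
          rw [one_div, inv_mul_cancel₀ (by positivity), Real.rpow_one]
    have h1 := hmain P hP M hMb ⟨tm, htm, rfl⟩ q hq1 hpow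
    refine h1.trans ?_
    have h3 : (1:ℝ)/2 * M ^ (-c) ≤ (1 + M) ^ (-c) := by
      calc (1:ℝ)/2 * M ^ (-c) ≤ 2 ^ (-c) * M ^ (-c) := by
            gcongr; exact h2c 2 (by norm_num) le_rfl
        _ = (2 * M) ^ (-c) := by rw [Real.mul_rpow (by norm_num) hM0]
        _ ≤ (1+M) ^ (-c) :=
            Real.rpow_le_rpow_of_nonpos (by linarith) (by linarith) (by linarith)
    have h4 : C / q ≤ 2 * C * M ^ (-c) := by
      rw [Real.rpow_neg hM0, ← div_eq_mul_inv, div_le_div_iff₀ (by linarith) (by linarith)]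
      nlinarith
    have h5 : 0 < M ^ (-c) := by positivity
    nlinarith

/-! ### Polynomial functions -/

/-- polynomial functions of degree at most `D` -/
def PF {n : ℕ} (D : ℕ) (f : (Fin n → ℝ) → ℝ) : Prop :=
  ∃ p : MvPolynomial (Fin n) ℝ, p.totalDegree ≤ D ∧ ∀ x, f x = MvPolynomial.eval x p

namespace PF
variable {n : ℕ}

lemma mono {D D' : ℕ} {f : (Fin n → ℝ) → ℝ} (h : PF D f) (hD : D ≤ D') : PF D' f := by
  obtain ⟨p, hp, hf⟩ := h
  exact ⟨p, hp.trans hD, hf⟩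

lemma const (D : ℕ) (c : ℝ) : PF D (fun _ : Fin n → ℝ => c) :=
  ⟨MvPolynomial.C c, by simp, by simp⟩

lemma coord (i : Fin n) : PF 1 (fun x : Fin n → ℝ => x i) :=
  ⟨MvPolynomial.X i, by simp, by simp⟩

lemma add {D : ℕ} {f g : (Fin n → ℝ) → ℝ} (hf : PF D f) (hg : PF D g) :
    PF D (fun x => f x + g x) := by
  obtain ⟨p, hp, hf⟩ := hf
  obtain ⟨q, hq, hg⟩ := hg
  exact ⟨p + q, (MvPolynomial.totalDegree_add _ _).trans (max_le hp hq), by simp [hf, hg]⟩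

lemma mul {D D' : ℕ} {f g : (Fin n → ℝ) → ℝ} (hf : PF D f) (hg : PF D' g) :
    PF (D + D') (fun x => f x * g x) := by
  obtain ⟨p, hp, hf⟩ := hf
  obtain ⟨q, hq, hg⟩ := hg
  exact ⟨p * q, (MvPolynomial.totalDegree_mul _ _).trans (add_le_add hp hq), by simp [hf, hg]⟩

lemma cmul {D : ℕ} {f : (Fin n → ℝ) → ℝ} (hf : PF D f) (c : ℝ) : PF D (fun x => c * f x) := by
  have := (const (n := n) 0 c).mul hf
  rwa [zero_add] at this

lemma sum {D : ℕ} {ι : Type*} (s : Finset ι) {f : ι → (Fin n → ℝ) → ℝ}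
    (hf : ∀ i ∈ s, PF D (f i)) : PF D (fun x => ∑ i ∈ s, f i x) := by
  classical
  induction s using Finset.induction_on with
  | empty => simpa using const D 0
  | insert a s ha ih =>
    have h1 := hf a (by simp)
    have h2 := ih (fun i hi => hf i (by simp [hi]))
    have := h1.add h2
    convert this using 2
    rw [Finset.sum_insert ha]

lemma pow {D : ℕ} {f : (Fin n → ℝ) → ℝ} (hf : PF D f) (k : ℕ) :
    PF (k * D) (fun x => f x ^ k) := by
  induction k with
  | zero => simpa using const 0 1
  | succ k ih =>
    have := ih.mul hf
    rw [Nat.succ_mul]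
    simpa [pow_succ] using this

lemma prod {ι : Type*} (s : Finset ι) (D : ι → ℕ) {f : ι → (Fin n → ℝ) → ℝ}
    (hf : ∀ i ∈ s, PF (D i) (f i)) : PF (∑ i ∈ s, D i) (fun x => ∏ i ∈ s, f i x) := by
  classical
  induction s using Finset.induction_on with
  | empty => simpa using const 0 1
  | insert a s ha ih =>
    have h1 := hf a (by simp)
    have h2 := ih (fun i hi => hf i (by simp [hi]))
    have := h1.mul h2
    rw [Finset.sum_insert ha]
    convert this using 2
    rw [Finset.prod_insert ha]

/-- expansion into monomials -/
lemma expand {D : ℕ} {f : (Fin n → ℝ) → ℝ} (hf : PF D f) :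
    ∃ (S : Finset (Fin n →₀ ℕ)) (c : (Fin n →₀ ℕ) → ℝ), (∀ b ∈ S, ∑ i, b i ≤ D) ∧
      ∀ x, f x = ∑ b ∈ S, c b * ∏ i, x i ^ b i := by
  obtain ⟨p, hp, hf⟩ := hf
  refine ⟨p.support, fun b => p.coeff b, ?_, ?_⟩
  · intro b hb
    have := (MvPolynomial.le_totalDegree hb).trans hp
    rwa [Finsupp.sum_fintype _ _ (by simp)] at this
  · intro x
    rw [hf, MvPolynomial.eval_eq']

lemma monom (b : Fin n →₀ ℕ) {D : ℕ} (hb : ∑ i, b i ≤ D) :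
    PF D (fun x : Fin n → ℝ => ∏ i, x i ^ b i) := by
  have := prod Finset.univ (fun i => b i * 1) (f := fun i (x : Fin n → ℝ) => x i ^ b i)
    (fun i _ => (coord i).pow (b i))
  simp only [mul_one] at this
  exact this.mono hb

lemma affine {D : ℕ} {f : (Fin n → ℝ) → ℝ} (hf : PF D f) (a : Fin n → ℝ) (r : ℝ) :
    PF D (fun x => f (a + r • x)) := by
  obtain ⟨S, c, hS, hf⟩ := hf.expand
  simp only [hf]
  apply sum
  intro b hb
  apply cmul
  have := prod Finset.univ (fun i => b i * 1)
    (f := fun i (x : Fin n → ℝ) => ((a + r • x) i) ^ b i)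
    (fun i _ => PF.pow (f := fun x : Fin n → ℝ => (a + r • x) i) (by
      simp only [Pi.add_apply, Pi.smul_apply, smul_eq_mul]
      exact (const 1 (a i)).add ((coord i).cmul r)) (b i))
  simp only [mul_one] at this
  exact this.mono (hS b hb)

lemma contDiff {D : ℕ} {f : (Fin n → ℝ) → ℝ} (hf : PF D f) : ContDiff ℝ ⊤ f := by
  obtain ⟨S, c, hS, hf⟩ := hf.expand
  have : f = fun x => ∑ b ∈ S, c b * ∏ i, x i ^ b i := funext hf
  rw [this]
  apply ContDiff.sum
  intro b _
  apply contDiff_const.mul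
  apply contDiff_prod
  intro i _
  exact (contDiff_apply ℝ ℝ i).pow _

lemma continuous {D : ℕ} {f : (Fin n → ℝ) → ℝ} (hf : PF D f) : Continuous f := hf.contDiff.continuous

lemma growth {D : ℕ} {f : (Fin n → ℝ) → ℝ} (hf : PF D f) :
    ∃ C : ℝ, 0 ≤ C ∧ ∀ ρ : ℝ, 1 ≤ ρ → ∀ y, ‖y‖ ≤ ρ → |f y| ≤ C * ρ ^ D := by
  obtain ⟨S, c, hS, hf⟩ := hf.expand
  refine ⟨∑ b ∈ S, |c b|, Finset.sum_nonneg fun _ _ => abs_nonneg _, ?_⟩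
  intro ρ hρ y hy
  rw [hf, Finset.sum_mul]
  refine (Finset.abs_sum_le_sum_abs _ _).trans (Finset.sum_le_sum ?_)
  intro b hb
  rw [abs_mul]
  gcongr
  rw [Finset.abs_prod]
  calc ∏ i, |y i ^ b i| ≤ ∏ i, ρ ^ b i := by
        apply Finset.prod_le_prod
        · intros; exact abs_nonneg _
        · intro i _
          rw [abs_pow]
          gcongr
          exact (norm_le_pi_norm y i).trans hy
    _ = ρ ^ (∑ i, b i) := by rw [Finset.prod_pow_eq_pow_sum]
    _ ≤ ρ ^ D := pow_le_pow_right₀ hρ (hS b hb)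

lemma ray_integral {D : ℕ} {f : (Fin n → ℝ) → ℝ} (hf : PF D f) :
    PF D (fun x => ∫ s in (0:ℝ)..1, f (s • x)) := by
  obtain ⟨S, c, hS, hf⟩ := hf.expand
  have : (fun x => ∫ s in (0:ℝ)..1, f (s • x)) =
      fun x => ∑ b ∈ S, (c b / ((∑ i, b i : ℕ) + 1)) * ∏ i, x i ^ b i := by
    funext x
    have h1 : ∀ s : ℝ, f (s • x) = ∑ b ∈ S, (c b * ∏ i, x i ^ b i) * s ^ (∑ i, b i) := by
      intro s
      rw [hf]
      apply Finset.sum_congr rfl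
      intro b _
      simp only [Pi.smul_apply, smul_eq_mul, mul_pow, Finset.prod_mul_distrib,
        Finset.prod_pow_eq_pow_sum]
      ring
    simp only [h1]
    rw [intervalIntegral.integral_finsetSum]
    · apply Finset.sum_congr rfl
      intro b _
      rw [intervalIntegral.integral_const_mul, integral_pow]
      simp
      ring
    · intro b _
      apply Continuous.intervalIntegrable
      fun_prop
  rw [this]
  apply sum
  intro b hb
  apply cmul
  exact monom b (hS b hb)

/-- functions with polynomial partial derivatives are polynomial -/
lemma antideriv {D : ℕ} {h : (Fin n → ℝ) → ℝ} (hd : Differentiable ℝ h)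
    (hp : ∀ j, PF D (fun x => fderiv ℝ h x (Pi.single j 1))) : PF (D + 1) h := by
  have hx : ∀ x y, fderiv ℝ h x y = ∑ j, y j * fderiv ℝ h x (Pi.single j 1) := by
    intro x y
    conv_lhs => rw [← Finset.univ_sum_single y, map_sum]
    apply Finset.sum_congr rfl
    intro j _
    have : (Pi.single j (y j) : Fin n → ℝ) = y j • Pi.single j (1:ℝ) := by
      rw [← Pi.single_smul, smul_eq_mul, mul_one]
    rw [this, map_smul, smul_eq_mul]
  have key : ∀ x, h x = h 0 + ∑ j, x j * ∫ s in (0:ℝ)..1, fderiv ℝ h (s • x) (Pi.single j 1) := by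
    intro x
    have hcont : ∀ j, Continuous fun s : ℝ => fderiv ℝ h (s • x) (Pi.single j 1) := fun j =>
      (hp j).continuous.comp (continuous_id.smul continuous_const)
    have h1 : ∀ s ∈ uIcc (0:ℝ) 1, HasDerivAt (fun s : ℝ => h (s • x))
        (∑ j, x j * fderiv ℝ h (s • x) (Pi.single j 1)) s := by
      intro s _
      rw [← hx]
      have h2 : HasDerivAt (fun s : ℝ => s • x) x s := by
        simpa using (hasDerivAt_id s).smul_const x
      exact (hd (s • x)).hasFDerivAt.comp_hasDerivAt s h2
    have h3 := intervalIntegral.integral_eq_sub_of_hasDerivAt h1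
      (Continuous.intervalIntegrable (continuous_finsetSum _
        fun j _ => continuous_const.mul (hcont j)) _ _)
    rw [intervalIntegral.integral_finsetSum
      (f := fun j (s : ℝ) => x j * fderiv ℝ h (s • x) (Pi.single j 1))
      (fun j _ => (continuous_const.mul (hcont j)).intervalIntegrable _ _)] at h3
    simp only [intervalIntegral.integral_const_mul, one_smul, zero_smul] at h3
    rw [h3]; ring
  have : h = fun x => h 0 + ∑ j, x j * ∫ s in (0:ℝ)..1, fderiv ℝ h (s • x) (Pi.single j 1) :=
    funext key
  rw [this]
  apply (const _ _).add
  apply sum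
  intro j _
  have := (coord j).mul (hp j).ray_integral
  rwa [add_comm] at this

/-- a polynomial curve separating monomials -/
def gam (D : ℕ) (s t : ℝ) : Fin n → ℝ := fun i => s * t ^ ((D+1) ^ (i : ℕ))

lemma gam_zero (D : ℕ) (s : ℝ) : gam (n := n) D s 0 = 0 := by
  funext i; simp [gam]

lemma gam_smul (D : ℕ) (s t : ℝ) : gam (n := n) D s t = s • gam D 1 t := by
  funext i; simp [gam]

lemma gam_cont (D : ℕ) (s : ℝ) : Continuous fun t => gam (n := n) D s t := by
  unfold gam; fun_prop

lemma gam_norm (D : ℕ) (s t : ℝ) (hs : 0 ≤ s) (ht : t ∈ Icc (0:ℝ) 1) :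
    ‖gam (n := n) D s t‖ ≤ s := by
  rw [pi_norm_le_iff_of_nonneg hs]
  intro i
  simp only [gam, norm_mul, norm_pow, Real.norm_eq_abs, abs_of_nonneg hs, abs_of_nonneg ht.1]
  have : t ^ ((D+1) ^ (i : ℕ)) ≤ 1 := pow_le_one₀ ht.1 ht.2
  nlinarith

lemma weight_inj {D : ℕ} (b b' : Fin n →₀ ℕ) (hb : ∑ i, b i ≤ D) (hb' : ∑ i, b' i ≤ D)
    (h : ∑ i, b i * (D+1) ^ (i : ℕ) = ∑ i, b' i * (D+1) ^ (i : ℕ)) : b = b' := by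
  have hl : ∀ (b : Fin n →₀ ℕ), ∑ i, b i ≤ D → ∀ i, b i < D + 1 := by
    intro b hb i
    exact Nat.lt_succ_of_le ((Finset.single_le_sum (f := fun i => b i) (fun _ _ => Nat.zero_le _)
      (Finset.mem_univ i)).trans hb)
  have hF : (fun i => (⟨b i, hl b hb i⟩ : Fin (D+1))) = fun i => ⟨b' i, hl b' hb' i⟩ := by
    apply finFunctionFinEquiv.injective
    apply Fin.ext
    rw [finFunctionFinEquiv_apply, finFunctionFinEquiv_apply]
    exact h
  ext i
  have := congrFun hF i
  simpa using this

/-- restriction to the curve is a polynomial, with coefficients given by those of `p` -/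
lemma curve_poly {D : ℕ} (p : MvPolynomial (Fin n) ℝ) (hp : p.totalDegree ≤ D) (s : ℝ) :
    ∃ P : Polynomial ℝ, P.natDegree ≤ D * (D+1) ^ n ∧
      (∀ t, P.eval t = MvPolynomial.eval (gam D s t) p) ∧
      ∀ b : Fin n →₀ ℕ, ∑ i, b i ≤ D →
        P.coeff (∑ i, b i * (D+1) ^ (i : ℕ)) = p.coeff b * s ^ (∑ i, b i) := by
  classical
  have hsup : ∀ b ∈ p.support, ∑ i, b i ≤ D := by
    intro b hb
    have := (MvPolynomial.le_totalDegree hb).trans hp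
    rwa [Finsupp.sum_fintype _ _ (by simp)] at this
  refine ⟨∑ b ∈ p.support, Polynomial.C (p.coeff b * s ^ (∑ i, b i)) *
    Polynomial.X ^ (∑ i, b i * (D+1) ^ (i : ℕ)), ?_, ?_, ?_⟩
  · apply Polynomial.natDegree_sum_le_of_forall_le
    intro b hb
    refine (Polynomial.natDegree_C_mul_X_pow_le _ _).trans ?_
    calc ∑ i, b i * (D+1) ^ (i : ℕ) ≤ ∑ i, b i * (D+1) ^ n := by
          apply Finset.sum_le_sum
          intro i _
          exact Nat.mul_le_mul_left _ (Nat.pow_le_pow_right (by omega) i.2.le)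
      _ = (∑ i, b i) * (D+1) ^ n := by rw [Finset.sum_mul]
      _ ≤ _ := Nat.mul_le_mul_right _ (hsup b hb)
  · intro t
    rw [Polynomial.eval_finsetSum, MvPolynomial.eval_eq']
    apply Finset.sum_congr rfl
    intro b _
    simp only [Polynomial.eval_mul, Polynomial.eval_C, Polynomial.eval_pow, Polynomial.eval_X, gam,
      mul_pow, Finset.prod_mul_distrib, Finset.prod_pow_eq_pow_sum, ← pow_mul]
    rw [mul_assoc]
    congr 3
    apply Finset.sum_congr rfl
    intro i _
    ring
  · intro b hb
    rw [Polynomial.finsetSum_coeff]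
    simp only [Polynomial.coeff_C_mul, Polynomial.coeff_X_pow]
    rw [Finset.sum_eq_single b]
    · simp
    · intro b' hb' hne
      rw [if_neg, mul_zero]
      intro heq
      exact hne (weight_inj b' b (hsup b' hb') hb heq.symm)
    · intro hnot
      rw [MvPolynomial.notMem_support_iff] at hnot
      simp [hnot]

/-- Interpolation for polynomial functions. -/
lemma interp (D : ℕ) (s : ℝ) (hs : 0 < s) : ∃ (m : ℕ) (t : Fin (m+1) → ℝ)
    (l : Fin (m+1) → (Fin n → ℝ) → ℝ), (∀ i, t i ∈ Icc (0:ℝ) 1) ∧ (∀ i, PF D (l i)) ∧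
    ∀ k, PF D k → ∀ x, k x = ∑ i, k (gam D s (t i)) * l i x := by
  classical
  set m := D * (D+1) ^ n with hm
  obtain ⟨v, hinj, hv⟩ := exists_nodes m
  have hfin : {b : Fin n →₀ ℕ | ∑ i, b i ≤ D}.Finite := by
    have := Finsupp.finite_of_degree_le (σ := Fin n) D
    simpa [Finsupp.degree_eq_sum] using this
  set S := hfin.toFinset with hS
  have hSm : ∀ b, b ∈ S ↔ ∑ i, b i ≤ D := by intro b; simp [hS]
  refine ⟨m, v, fun i x => ∑ b ∈ S, ((s ^ (∑ i, b i))⁻¹ *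
    (Lagrange.basis Finset.univ v i).coeff (∑ i, b i * (D+1) ^ (i : ℕ))) * ∏ i, x i ^ b i,
    hv, ?_, ?_⟩
  · intro i
    apply sum
    intro b hb
    exact (monom b ((hSm b).mp hb)).cmul _
  · rintro k ⟨p, hp, hk⟩ x
    obtain ⟨P, hPd, hPe, hPc⟩ := curve_poly p hp s
    have h1 : k x = ∑ b ∈ S, p.coeff b * ∏ i, x i ^ b i := by
      rw [hk, MvPolynomial.eval_eq']
      apply Finset.sum_subset
      · intro b hb
        rw [hSm]
        have := (MvPolynomial.le_totalDegree hb).trans hp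
        rwa [Finsupp.sum_fintype _ _ (by simp)] at this
      · intro b _ hnot
        rw [MvPolynomial.notMem_support_iff] at hnot
        simp [hnot]
    have h2 : ∀ b ∈ S, p.coeff b = ∑ i, k (gam D s (v i)) * ((s ^ (∑ i, b i))⁻¹ *
        (Lagrange.basis Finset.univ v i).coeff (∑ i, b i * (D+1) ^ (i : ℕ))) := by
      intro b hb
      have h3 := hPc b ((hSm b).mp hb)
      have h4 := congrArg (fun R : Polynomial ℝ => R.coeff (∑ i, b i * (D+1) ^ (i : ℕ)))
        (lag_eq P hPd v hinj)
      simp only [Polynomial.finsetSum_coeff, Polynomial.coeff_C_mul] at h4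
      rw [h3] at h4
      have h5 : p.coeff b = (s ^ (∑ i, b i))⁻¹ * (p.coeff b * s ^ (∑ i, b i)) := by
        field_simp
      rw [h5, h4, Finset.mul_sum]
      apply Finset.sum_congr rfl
      intro i _
      rw [hPe, hk]
      ring
    rw [h1]
    simp only [Finset.mul_sum]
    rw [Finset.sum_comm]
    apply Finset.sum_congr rfl
    intro b hb
    rw [h2 b hb, Finset.sum_mul]
    apply Finset.sum_congr rfl
    intro i _
    ring

/-- oscillatory integrals along the curve -/
lemma osc_curve (n D : ℕ) : ∃ C c : ℝ, 0 < C ∧ 0 < c ∧ ∀ k : (Fin n → ℝ) → ℝ, PF D k →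
    ∀ ρ : ℝ, 1 ≤ ρ → ∀ y, ‖y‖ ≤ ρ →
    ‖∫ t in (0:ℝ)..1, expi (k (gam D 1 t))‖ ≤ C * (1 + |k y - k 0| / ρ ^ D) ^ (-c) := by
  obtain ⟨C, c, hC, hc, hosc⟩ := osc_one (D * (D+1) ^ n)
  obtain ⟨m, t, l, ht, hl, hint⟩ := interp (n := n) D 1 one_pos
  choose B hB0 hB using fun i => (hl i).growth
  set T := (∑ i, B i) + 1 with hT
  have hB1 : 0 ≤ ∑ i, B i := Finset.sum_nonneg fun i _ => hB0 i
  have hT1 : 1 ≤ T := by linarith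
  have hT0 : 0 < T := by linarith
  refine ⟨C * T ^ c, c, by positivity, hc, ?_⟩
  intro k hk ρ hρ y hy
  have hk' := hk.add (const D (-(k 0)))
  have h1 := hint _ hk' y
  obtain ⟨i0, hi0⟩ := Finite.exists_max fun i => |k (gam D 1 (t i)) - k 0|
  set X := |k (gam D 1 (t i0)) - k 0| with hX
  have hX0 : 0 ≤ X := abs_nonneg _
  have h2 : |k y - k 0| ≤ X * (T * ρ ^ D) := by
    have : k y - k 0 = ∑ i, (k (gam D 1 (t i)) - k 0) * l i y := by
      simpa [sub_eq_add_neg] using h1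
    rw [this]
    calc _ ≤ ∑ i, |(k (gam D 1 (t i)) - k 0) * l i y| := Finset.abs_sum_le_sum_abs _ _
      _ ≤ ∑ i, X * (B i * ρ ^ D) := by
          apply Finset.sum_le_sum
          intro i _
          rw [abs_mul]
          exact mul_le_mul (hi0 i) (hB i ρ hρ y hy) (abs_nonneg _) hX0
      _ = X * ((∑ i, B i) * ρ ^ D) := by rw [← Finset.mul_sum, ← Finset.sum_mul]
      _ ≤ X * (T * ρ ^ D) := by gcongr; linarith
  obtain ⟨p, hp, hkp⟩ := hk
  obtain ⟨P, hPd, hPe, -⟩ := curve_poly p hp 1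
  have h3 := hosc P hPd (t i0) (ht i0) 0 (by simp)
  have hPk : ∀ t, P.eval t = k (gam D 1 t) := fun t => by rw [hPe, hkp]
  simp only [hPk, gam_zero] at h3
  refine h3.trans ?_
  rw [mul_assoc]
  gcongr
  have hρ0 : 0 < ρ ^ D := by positivity
  set Y := |k y - k 0| / ρ ^ D with hY
  have hY0 : 0 ≤ Y := by positivity
  have h4 : Y ≤ X * T := by
    rw [hY, div_le_iff₀ hρ0]; linarith
  calc (1 + X) ^ (-c) ≤ ((1 + Y) / T) ^ (-c) := by
        apply Real.rpow_le_rpow_of_nonpos (by positivity) _ (by linarith)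
        rw [div_le_iff₀ hT0]; nlinarith
    _ = T ^ c * (1 + Y) ^ (-c) := by
        rw [Real.div_rpow (by positivity) (by positivity), Real.rpow_neg hT0.le]
        field_simp

end PF


theorem mvp_contDiff {ι : Type*} [Fintype ι] (p : MvPolynomial ι ℝ) {k : WithTop ℕ∞} :
    ContDiff ℝ k (fun x : ι → ℝ => MvPolynomial.eval x p) := by
  induction p using MvPolynomial.induction_on with
  | C a => simpa using contDiff_const
  | add p q hp hq => simpa using hp.add hq
  | mul_X p i hp => simpa using hp.mul (contDiff_apply ℝ ℝ i)

/-- The dilation as a continuous linear map. -/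
def dilL {n : ℕ} (σ : Fin n → ℝ) (l : ℝ) : (Fin n → ℝ) →L[ℝ] (Fin n → ℝ) :=
  LinearMap.toContinuousLinearMap (Matrix.toLin' (Matrix.diagonal fun i => l ^ σ i))

theorem dilL_apply {n : ℕ} (σ : Fin n → ℝ) (l : ℝ) (x : Fin n → ℝ) :
    dilL σ l x = dil σ l x := by
  ext i
  simp [dilL, dil, Matrix.mulVec_diagonal]

theorem dilL_det {n : ℕ} (σ : Fin n → ℝ) (l : ℝ) : (dilL σ l).det = ∏ i, l ^ σ i := by
  simp [dilL, ContinuousLinearMap.det]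

theorem dilL_det_pos {n : ℕ} (σ : Fin n → ℝ) {l : ℝ} (hl : 0 < l) : 0 < (dilL σ l).det := by
  rw [dilL_det]
  exact Finset.prod_pos fun i _ => Real.rpow_pos_of_pos hl _

theorem dil_tendsto {n : ℕ} (σ : Fin n → ℝ) (hσ : ∀ i, 1 ≤ σ i) (x : Fin n → ℝ) :
    Tendsto (fun l : ℝ => dil σ l x) (nhdsWithin 0 (Ioi 0)) (nhds 0) := by
  rw [tendsto_pi_nhds]
  intro i
  have h1 : ContinuousAt (fun l : ℝ => l ^ σ i) 0 :=
    Real.continuousAt_rpow_const 0 (σ i) (Or.inr (by linarith [hσ i]))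
  have h2 := (h1.tendsto.mono_left (nhdsWithin_le_nhds (s := Ioi (0:ℝ)))).mul_const (x i)
  rw [Real.zero_rpow (by linarith [hσ i]), zero_mul] at h2
  simpa [dil] using h2

theorem fderiv_partial {n : ℕ} {m : (Fin n → ℝ) × (Fin n → ℝ) → (Fin n → ℝ)}
    (hm : ContDiff ℝ 1 m) (x z : Fin n → ℝ) :
    HasFDerivAt (fun x' => m (x', z))
      ((fderiv ℝ m (x, z)).comp (ContinuousLinearMap.inl ℝ (Fin n → ℝ) (Fin n → ℝ))) x := by
  have h1 : HasFDerivAt m (fderiv ℝ m (x, z)) (x, z) :=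
    (hm.differentiable (by norm_num) (x, z)).hasFDerivAt
  exact h1.comp x (hasFDerivAt_prodMk_left x z)

theorem det_one {n : ℕ} (σ : Fin n → ℝ) (hσ : ∀ i, 1 ≤ σ i)
    {m : (Fin n → ℝ) × (Fin n → ℝ) → (Fin n → ℝ)}
    (hm : ContDiff ℝ 1 m)
    (hd : ∀ l : ℝ, 0 < l → ∀ x z, m (dil σ l x, dil σ l z) = dil σ l (m (x, z)))
    (h0 : ∀ x, m (x, 0) = x) (x z : Fin n → ℝ) :
    ((fderiv ℝ m (x, z)).comp
      (ContinuousLinearMap.inl ℝ (Fin n → ℝ) (Fin n → ℝ))).det = 1 := by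
  set F : (Fin n → ℝ) × (Fin n → ℝ) → ((Fin n → ℝ) →L[ℝ] (Fin n → ℝ)) := fun q =>
    (fderiv ℝ m q).comp (ContinuousLinearMap.inl ℝ (Fin n → ℝ) (Fin n → ℝ)) with hF
  have hFc : Continuous fun q => (F q).det := by
    apply ContinuousLinearMap.continuous_det.comp
    exact (hm.continuous_fderiv (by norm_num)).clm_comp continuous_const
  have hF0 : F (0, 0) = ContinuousLinearMap.id ℝ _ := by
    have h1 := fderiv_partial hm 0 0
    have h2 : (fun x' => m (x', 0)) = fun x' => x' := by funext x'; exact h0 x'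
    rw [h2] at h1
    exact h1.unique (hasFDerivAt_id _)
  have hinv : ∀ l : ℝ, 0 < l → (F (dil σ l x, dil σ l z)).det = (F (x, z)).det := by
    intro l hl
    have h1 := fderiv_partial hm (dilL σ l x) (dil σ l z)
    have h2 := h1.comp x (dilL σ l).hasFDerivAt
    have h3 := (dilL σ l).hasFDerivAt.comp x (fderiv_partial hm x z)
    have h4 : ((fun x' => m (x', dil σ l z)) ∘ (dilL σ l)) =
        ((dilL σ l) ∘ fun x' => m (x', z)) := by
      funext y
      simp only [Function.comp, dilL_apply]
      exact hd l hl y z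
    rw [h4] at h2
    have h5 := h2.unique h3
    have h6 := congrArg (fun T : (Fin n → ℝ) →L[ℝ] (Fin n → ℝ) => LinearMap.det (T : (Fin n → ℝ) →ₗ[ℝ] (Fin n → ℝ))) h5
    simp only [ContinuousLinearMap.toLinearMap_comp, LinearMap.det_comp] at h6
    have h7 : LinearMap.det (dilL σ l : (Fin n → ℝ) →ₗ[ℝ] (Fin n → ℝ)) ≠ 0 :=
      (dilL_det_pos σ hl).ne'
    rw [mul_comm (LinearMap.det (dilL σ l : (Fin n → ℝ) →ₗ[ℝ] (Fin n → ℝ)))] at h6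
    rw [dilL_apply] at h6
    have h8 := mul_right_cancel₀ h7 h6
    simp only [hF, ContinuousLinearMap.det, ContinuousLinearMap.toLinearMap_comp]
    exact h8
  have ht : Tendsto (fun l : ℝ => (F (dil σ l x, dil σ l z)).det) (nhdsWithin 0 (Ioi 0))
      (nhds (F (0, 0)).det) :=
    (hFc.tendsto (0, 0)).comp ((dil_tendsto σ hσ x).prodMk_nhds (dil_tendsto σ hσ z))
  have ht2 : Tendsto (fun l : ℝ => (F (dil σ l x, dil σ l z)).det) (nhdsWithin 0 (Ioi 0))
      (nhds (F (x, z)).det) := by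
    apply tendsto_const_nhds.congr'
    filter_upwards [self_mem_nhdsWithin] with l hl
    exact (hinv l hl).symm
  have := tendsto_nhds_unique ht2 ht
  rw [hF0] at this
  have h9 : (ContinuousLinearMap.id ℝ (Fin n → ℝ)).det = 1 := by simp [ContinuousLinearMap.det]
  rw [h9] at this
  exact this

namespace HomLieGroup
variable {n : ℕ} (G : HomLieGroup n)

theorem mul_contDiff {k : WithTop ℕ∞} :
    ContDiff ℝ k (fun q : (Fin n → ℝ) × (Fin n → ℝ) => G.mul q.1 q.2) := by
  obtain ⟨p, hp⟩ := G.mul_isPoly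
  rw [contDiff_pi]
  intro i
  simp_rw [hp]
  apply (mvp_contDiff (p i)).comp
  rw [contDiff_pi]
  rintro (j | j)
  · exact (contDiff_apply ℝ ℝ j).comp contDiff_fst
  · exact (contDiff_apply ℝ ℝ j).comp contDiff_snd

theorem mul_cont {X : Type*} [TopologicalSpace X] {f g : X → (Fin n → ℝ)} (hf : Continuous f)
    (hg : Continuous g) : Continuous fun x => G.mul (f x) (g x) :=
  (G.mul_contDiff (k := 0)).continuous.comp (hf.prodMk hg)

theorem inv_mul_cancel_left (x y : Fin n → ℝ) : G.mul (G.inv x) (G.mul x y) = y := by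
  rw [← G.mul_assoc, G.inv_mul, G.zero_mul]

theorem mul_inv_cancel_left (x y : Fin n → ℝ) : G.mul x (G.mul (G.inv x) y) = y := by
  rw [← G.mul_assoc, G.mul_inv, G.zero_mul]

theorem mul_inv_cancel_right (x y : Fin n → ℝ) : G.mul (G.mul x y) (G.inv y) = x := by
  rw [G.mul_assoc, G.mul_inv, G.mul_zero]

theorem inv_mul_cancel_right (x y : Fin n → ℝ) : G.mul (G.mul x (G.inv y)) y = x := by
  rw [G.mul_assoc, G.inv_mul, G.mul_zero]

theorem eq_inv_of_mul {x y : Fin n → ℝ} (h : G.mul x y = 0) : x = G.inv y := by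
  rw [← G.mul_inv_cancel_right x y, h, G.zero_mul]

theorem inv_inv (x : Fin n → ℝ) : G.inv (G.inv x) = x :=
  (G.eq_inv_of_mul (G.mul_inv x)).symm

theorem inv_zero : G.inv 0 = 0 := (G.eq_inv_of_mul (G.mul_zero 0)).symm

theorem inv_mul_rev (x y : Fin n → ℝ) : G.inv (G.mul x y) = G.mul (G.inv y) (G.inv x) := by
  symm
  apply G.eq_inv_of_mul
  rw [G.mul_assoc, G.inv_mul_cancel_left, G.inv_mul]

theorem dil_zero (σ : Fin n → ℝ) (l : ℝ) : dil σ l 0 = 0 := by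
  ext i; simp [dil]

theorem inv_dil {l : ℝ} (hl : 0 < l) (x : Fin n → ℝ) :
    G.inv (dil G.σ l x) = dil G.σ l (G.inv x) := by
  symm
  apply G.eq_inv_of_mul
  rw [← G.dil_mul l hl, G.inv_mul, dil_zero]

theorem rightT_hasFDeriv (z x : Fin n → ℝ) :
    ∃ T : (Fin n → ℝ) →L[ℝ] (Fin n → ℝ), T.det = 1 ∧ HasFDerivAt (fun x' => G.mul x' z) T x :=
  ⟨_, det_one G.σ G.one_le_σ G.mul_contDiff (fun l hl x z => (G.dil_mul l hl x z).symm)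
    G.mul_zero x z, fderiv_partial G.mul_contDiff x z⟩

theorem leftT_hasFDeriv (z x : Fin n → ℝ) :
    ∃ T : (Fin n → ℝ) →L[ℝ] (Fin n → ℝ), T.det = 1 ∧ HasFDerivAt (fun x' => G.mul z x') T x := by
  have hm : ContDiff ℝ 1 (fun q : (Fin n → ℝ) × (Fin n → ℝ) => G.mul q.2 q.1) :=
    G.mul_contDiff.comp (contDiff_snd.prodMk contDiff_fst)
  exact ⟨_, det_one G.σ G.one_le_σ hm (fun l hl x z => (G.dil_mul l hl z x).symm)
    G.zero_mul x z, fderiv_partial hm x z⟩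

/-- `(x,y) ↦ x⁻¹ ∘ y` is `C^1`. -/
theorem psi_contDiff :
    ContDiff ℝ 1 (fun q : (Fin n → ℝ) × (Fin n → ℝ) => G.mul (G.inv q.1) q.2) := by
  set Φ : (Fin n → ℝ) × (Fin n → ℝ) → (Fin n → ℝ) × (Fin n → ℝ) :=
    fun q => (q.1, G.mul q.1 q.2) with hΦ
  set Ψ : (Fin n → ℝ) × (Fin n → ℝ) → (Fin n → ℝ) × (Fin n → ℝ) :=
    fun q => (q.1, G.mul (G.inv q.1) q.2) with hΨ
  have hΦc : ContDiff ℝ 1 Φ := contDiff_fst.prodMk G.mul_contDiff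
  have hΨΦ : ∀ q, Ψ (Φ q) = q := fun q => by simp [hΦ, hΨ, G.inv_mul_cancel_left]
  have hΦΨ : ∀ q, Φ (Ψ q) = q := fun q => by simp [hΦ, hΨ, G.mul_inv_cancel_left]
  have key : ContDiff ℝ 1 Ψ := by
    rw [contDiff_iff_contDiffAt]
    intro b
    obtain ⟨a, rfl⟩ : ∃ a, Φ a = b := ⟨Ψ b, hΦΨ b⟩
    set D := fderiv ℝ (fun q : (Fin n → ℝ) × (Fin n → ℝ) => G.mul q.1 q.2) a with hD
    have hmd : HasFDerivAt (fun q : (Fin n → ℝ) × (Fin n → ℝ) => G.mul q.1 q.2) D a :=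
      (G.mul_contDiff.differentiable (n := 1) (by norm_num) a).hasFDerivAt
    have hΦd : HasFDerivAt Φ ((ContinuousLinearMap.fst ℝ (Fin n → ℝ) (Fin n → ℝ)).prod D) a :=
      hasFDerivAt_fst.prodMk hmd
    have hinj : Function.Injective
        (((ContinuousLinearMap.fst ℝ (Fin n → ℝ) (Fin n → ℝ)).prod D :
          (Fin n → ℝ) × (Fin n → ℝ) →L[ℝ] (Fin n → ℝ) × (Fin n → ℝ)) :
          (Fin n → ℝ) × (Fin n → ℝ) →ₗ[ℝ] (Fin n → ℝ) × (Fin n → ℝ)) := by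
      rw [← LinearMap.ker_eq_bot, LinearMap.ker_eq_bot']
      rintro ⟨u, v⟩ huv
      have h1 : u = 0 := congrArg Prod.fst huv
      have h2 : D (u, v) = 0 := congrArg Prod.snd huv
      subst h1
      obtain ⟨T, hT1, hT⟩ := G.leftT_hasFDeriv a.1 a.2
      have h3 : HasFDerivAt (fun x' => G.mul a.1 x')
          (D.comp (ContinuousLinearMap.inr ℝ (Fin n → ℝ) (Fin n → ℝ))) a.2 :=
        HasFDerivAt.comp (f := fun y : Fin n → ℝ => (a.1, y))
          (g := fun q : (Fin n → ℝ) × (Fin n → ℝ) => G.mul q.1 q.2)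
          a.2 (hmd) (hasFDerivAt_prodMk_right a.1 a.2)
      have h4 := hT.unique h3
      have h5 : T v = 0 := by rw [h4]; simpa using h2
      have h6 : IsUnit (LinearMap.det (T : (Fin n → ℝ) →ₗ[ℝ] (Fin n → ℝ))) := by
        have : LinearMap.det (T : (Fin n → ℝ) →ₗ[ℝ] (Fin n → ℝ)) = 1 := hT1
        rw [this]; exact isUnit_one
      have h8 : LinearMap.ker (T : (Fin n → ℝ) →ₗ[ℝ] (Fin n → ℝ)) = ⊥ := by
        by_contra hb
        have := LinearMap.det_eq_zero_iff_ker_ne_bot.mpr hb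
        rw [this] at h6
        exact not_isUnit_zero h6
      have h9 : v = 0 := by
        rw [LinearMap.ker_eq_bot'] at h8
        exact h8 v h5
      rw [h9]; rfl
    set e := (LinearEquiv.ofInjectiveEndo _ hinj).toContinuousLinearEquiv with he
    have hΦe : HasFDerivAt Φ (e : (Fin n → ℝ) × (Fin n → ℝ) →L[ℝ] (Fin n → ℝ) × (Fin n → ℝ)) a := by
      convert hΦd using 1
      ext q <;> rfl
    have hl := hΦc.contDiffAt.to_localInverse hΦe (by norm_num)
    have hu := (hΦc.contDiffAt.hasStrictFDerivAt' hΦe (by norm_num)).localInverse_unique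
      (g := Ψ) (Eventually.of_forall hΨΦ)
    exact hl.congr_of_eventuallyEq hu
  exact contDiff_snd.comp key

theorem inv_contDiff : ContDiff ℝ 1 G.inv := by
  have := G.psi_contDiff.comp (contDiff_id.prodMk (contDiff_const (c := (0 : Fin n → ℝ))))
  simpa [Function.comp_def, G.mul_zero] using this

theorem inv_cont {X : Type*} [TopologicalSpace X] {f : X → (Fin n → ℝ)} (hf : Continuous f) :
    Continuous fun x => G.inv (f x) := G.inv_contDiff.continuous.comp hf

end HomLieGroup


namespace HomLieGroup
variable {n : ℕ} (G : HomLieGroup n)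

theorem leib_succ {d : ℕ} {f : (Fin n → ℝ) → ℝ} :
    G.IsLeibman (d+1) f ↔ ∀ w, G.IsLeibman d (fun x => f (G.mul x w) - f x) := by
  constructor
  · intro h w
    have := h (G.inv w)
    simpa only [G.inv_inv] using this
  · intro h g
    exact h (G.inv g)

theorem leib_zero {f : (Fin n → ℝ) → ℝ} (h : G.IsLeibman 0 f) (x : Fin n → ℝ) : f x = f 0 := by
  have := h (G.inv x) 0
  rw [G.inv_inv, G.zero_mul] at this
  linarith

theorem leib_sub {d : ℕ} : ∀ {f g : (Fin n → ℝ) → ℝ}, G.IsLeibman d f → G.IsLeibman d g →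
    G.IsLeibman d (fun x => f x - g x) := by
  induction d with
  | zero =>
    intro f g hf hg a b
    have h1 := hf a b
    have h2 := hg a b
    linarith
  | succ d ih =>
    intro f g hf hg
    rw [leib_succ] at hf hg ⊢
    intro w
    have := ih (hf w) (hg w)
    convert this using 2
    ring

theorem leib_comp {d : ℕ} {T θ : (Fin n → ℝ) → (Fin n → ℝ)}
    (hT : ∀ x w, T (G.mul x w) = G.mul (T x) (θ w)) :
    ∀ {f : (Fin n → ℝ) → ℝ}, G.IsLeibman d f → G.IsLeibman d (fun x => f (T x)) := by
  induction d with
  | zero =>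
    intro f hf a b
    have h1 := G.leib_zero hf (T (G.mul b (G.inv a)))
    have h2 := G.leib_zero hf (T b)
    show f (T (G.mul b (G.inv a))) - f (T b) = 0
    linarith
  | succ d ih =>
    intro f hf
    rw [leib_succ] at hf ⊢
    intro w
    have := ih (hf (θ w))
    simpa only [hT] using this

/-- Powers in the group. -/
def pw (w : Fin n → ℝ) : ℕ → (Fin n → ℝ)
  | 0 => 0
  | j+1 => G.mul (pw w j) w

theorem pw_cont (j : ℕ) : Continuous fun w => G.pw w j := by
  induction j with
  | zero => exact continuous_const
  | succ j ih => exact G.mul_cont ih continuous_id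

theorem pw_zero (j : ℕ) : G.pw 0 j = 0 := by
  induction j with
  | zero => rfl
  | succ j ih => simp [pw, ih, G.mul_zero]

theorem leib_cont {D m : ℕ} {r M : ℝ} (hr : 0 < r) {h : (Fin n → ℝ) → ℝ}
    {pt : Fin m → (Fin n → ℝ)} {l : Fin m → (Fin n → ℝ) → ℝ} (hl : ∀ i, PF D (l i))
    (hM : ∀ w, ‖w‖ < r → ∀ i, |h (G.mul (pt i) w) - h (pt i)| ≤ M)
    (hN : ∀ w, ‖w‖ < r → ∀ x, h (G.mul x w) - h x =
      ∑ i, (h (G.mul (pt i) w) - h (pt i)) * l i x) : Continuous h := by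
  have step : ∀ x, Tendsto (fun w => h (G.mul x w) - h x) (nhds 0) (nhds 0) := by
    intro x
    rw [Metric.tendsto_nhds]
    intro η hη
    have hAb : ∀ w, ‖w‖ < r → |h (G.mul x w) - h x| ≤ M * ∑ i, |l i x| := by
      intro w hw
      rw [hN w hw x, Finset.mul_sum]
      refine (Finset.abs_sum_le_sum_abs _ _).trans (Finset.sum_le_sum fun i _ => ?_)
      rw [abs_mul]
      exact mul_le_mul_of_nonneg_right (hM w hw i) (abs_nonneg _)
    set A := M * ∑ i, |l i x| with hA
    have hA0 : 0 ≤ A := (abs_nonneg _).trans (hAb 0 (by simpa using hr))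
    obtain ⟨N, hNN⟩ := exists_nat_gt (A / (η/2))
    have hN0 : 0 < (N:ℝ) := lt_of_le_of_lt (by positivity) hNN
    have hdiff : ∀ w, ‖w‖ < r → ∀ y, |(h (G.mul y w) - h y) - (h (G.mul x w) - h x)| ≤
        M * ∑ i, |l i y - l i x| := by
      intro w hw y
      rw [hN w hw y, hN w hw x, ← Finset.sum_sub_distrib, Finset.mul_sum]
      refine (Finset.abs_sum_le_sum_abs _ _).trans (Finset.sum_le_sum fun i _ => ?_)
      rw [← mul_sub, abs_mul]
      exact mul_le_mul_of_nonneg_right (hM w hw i) (abs_nonneg _)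
    have hΛ : ∀ j, Tendsto (fun w => M * ∑ i, |l i (G.mul x (G.pw w j)) - l i x|) (nhds 0)
        (nhds 0) := by
      intro j
      have hc : Continuous (fun w => M * ∑ i, |l i (G.mul x (G.pw w j)) - l i x|) := by
        refine continuous_const.mul (continuous_finsetSum _ fun i _ => ?_)
        exact (((hl i).continuous.comp (G.mul_cont continuous_const (G.pw_cont j))).sub
          continuous_const).abs
      have := hc.tendsto 0
      simpa [G.pw_zero, G.mul_zero] using this
    have hev : ∀ᶠ w in nhds (0 : Fin n → ℝ), ∀ j ∈ Finset.range (N+1),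
        M * ∑ i, |l i (G.mul x (G.pw w j)) - l i x| < η/2 ∧ ‖G.pw w j‖ < r := by
      rw [Filter.eventually_all_finset]
      intro j _
      refine ((hΛ j).eventually (gt_mem_nhds (by positivity))).and ?_
      have h1 : Tendsto (fun w => ‖G.pw w j‖) (nhds 0) (nhds 0) := by
        have := (G.pw_cont j).norm.tendsto 0
        simpa [G.pw_zero] using this
      exact h1.eventually (gt_mem_nhds hr)
    have hev2 : ∀ᶠ w in nhds (0 : Fin n → ℝ), ‖w‖ < r := by
      have : Tendsto (fun w : Fin n → ℝ => ‖w‖) (nhds 0) (nhds 0) := by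
        simpa using continuous_norm.tendsto (0 : Fin n → ℝ)
      exact this.eventually (gt_mem_nhds hr)
    filter_upwards [hev, hev2] with w hw hwr
    rw [Real.dist_eq, sub_zero]
    have htel : ∑ j ∈ Finset.range N, (h (G.mul (G.mul x (G.pw w j)) w) - h (G.mul x (G.pw w j)))
        = h (G.mul x (G.pw w N)) - h x := by
      have := Finset.sum_range_sub (fun j => h (G.mul x (G.pw w j))) N
      simpa [pw, G.mul_assoc, G.mul_zero] using this
    have hid : (N:ℝ) * (h (G.mul x w) - h x) = (h (G.mul x (G.pw w N)) - h x) -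
        ∑ j ∈ Finset.range N, ((h (G.mul (G.mul x (G.pw w j)) w) - h (G.mul x (G.pw w j)))
          - (h (G.mul x w) - h x)) := by
      rw [Finset.sum_sub_distrib, htel]
      simp
      ring
    have h1 : |h (G.mul x (G.pw w N)) - h x| ≤ A :=
      hAb _ (hw N (by simp)).2
    have h2 : |∑ j ∈ Finset.range N, ((h (G.mul (G.mul x (G.pw w j)) w) - h (G.mul x (G.pw w j)))
          - (h (G.mul x w) - h x))| ≤ ∑ j ∈ Finset.range N, η/2 := by
      refine (Finset.abs_sum_le_sum_abs _ _).trans (Finset.sum_le_sum fun j hj => ?_)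
      exact (hdiff w hwr _).trans (hw j (by simp at hj ⊢; omega)).1.le
    rw [Finset.sum_const, Finset.card_range, nsmul_eq_mul] at h2
    have h3 : |(N:ℝ) * (h (G.mul x w) - h x)| ≤ A + N * (η/2) := by
      rw [hid]
      exact (abs_sub _ _).trans (add_le_add h1 h2)
    rw [abs_mul, abs_of_pos hN0] at h3
    rw [div_lt_iff₀ (by positivity)] at hNN
    have h4 : (N:ℝ) * |h (G.mul x w) - h x| < N * η := by nlinarith
    exact lt_of_mul_lt_mul_left h4 hN0.le
  rw [continuous_iff_continuousAt]
  intro x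
  have h1 : Tendsto (fun y => G.mul (G.inv x) y) (nhds x) (nhds 0) := by
    have := (G.mul_cont (continuous_const (y := G.inv x)) continuous_id).tendsto x
    simpa [G.inv_mul] using this
  have h2 := ((step x).comp h1).add_const (h x)
  simp only [Function.comp_def, G.mul_inv_cancel_left, sub_add_cancel, zero_add] at h2
  exact h2

theorem integral_left (x : Fin n → ℝ) (F : (Fin n → ℝ) → ℝ) :
    ∫ y, F y = ∫ g, F (G.mul x g) := by
  choose T hT1 hT using G.leftT_hasFDeriv x
  have := integral_image_eq_integral_abs_det_fderiv_smul (volume : Measure (Fin n → ℝ))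
    (f := fun g => G.mul x g) (f' := T) MeasurableSet.univ (fun g _ => (hT g).hasFDerivWithinAt)
    (fun a _ b _ hab => by
      have := congrArg (G.mul (G.inv x)) hab
      simpa [G.inv_mul_cancel_left] using this) F
  have him : (fun g => G.mul x g) '' univ = univ := by
    rw [image_univ]
    exact range_eq_univ.mpr fun y => ⟨G.mul (G.inv x) y, G.mul_inv_cancel_left x y⟩
  rw [him] at this
  simpa [hT1] using this

theorem leib_C1 {D m : ℕ} {r : ℝ} (hr : 0 < r) {h : (Fin n → ℝ) → ℝ}
    {pt : Fin m → (Fin n → ℝ)} {l : Fin m → (Fin n → ℝ) → ℝ} (hl : ∀ i, PF D (l i))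
    (hc : Continuous h)
    (hN : ∀ w, ‖w‖ < r → ∀ x, h (G.mul x w) - h x =
      ∑ i, (h (G.mul (pt i) w) - h (pt i)) * l i x) : ContDiff ℝ 1 h := by
  let χ : ContDiffBump (0 : Fin n → ℝ) := ⟨r/4, r/2, by positivity, by linarith⟩
  have hχc : Continuous χ := χ.continuous
  have hχs : HasCompactSupport χ := χ.hasCompactSupport
  have hχ0 : ∀ g, r ≤ ‖g‖ → χ g = 0 := by
    intro g hg
    apply χ.zero_of_le_dist
    show r/2 ≤ _
    rw [dist_zero_right]; linarith
  have hint : ∀ F : (Fin n → ℝ) → ℝ, Continuous F → Integrable (fun g => F g * χ g) := by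
    intro F hF
    exact (hF.mul hχc).integrable_of_hasCompactSupport hχs.mul_left
  have hI0 : 0 < ∫ g, χ g := χ.integral_pos
  set H : (Fin n → ℝ) → ℝ := fun x => ∫ g, h (G.mul x g) * χ g with hH
  have hH1 : ∀ x, H x = h x * (∫ g, χ g) +
      ∑ i, (∫ g, (h (G.mul (pt i) g) - h (pt i)) * χ g) * l i x := by
    intro x
    have h1 : ∀ g, h (G.mul x g) * χ g = h x * χ g +
        ∑ i, ((h (G.mul (pt i) g) - h (pt i)) * χ g) * l i x := by
      intro g
      by_cases hg : ‖g‖ < r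
      · have h2 := hN g hg x
        have h3 : h (G.mul x g) = h x + ∑ i, (h (G.mul (pt i) g) - h (pt i)) * l i x := by
          rw [← h2]; ring
        rw [h3, add_mul, Finset.sum_mul]
        congr 1
        exact Finset.sum_congr rfl fun i _ => by ring
      · simp [hχ0 g (not_lt.mp hg)]
    have hi2 : ∀ i, Integrable (fun g => ((h (G.mul (pt i) g) - h (pt i)) * χ g) * l i x) := by
      intro i
      exact (hint _ ((hc.comp (G.mul_cont continuous_const continuous_id)).sub
        continuous_const)).mul_const _
    simp only [hH]
    rw [integral_congr_ae (Eventually.of_forall h1), integral_add (hint _ continuous_const)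
      (integrable_finsetSum _ fun i _ => hi2 i), integral_const_mul,
      integral_finsetSum _ fun i _ => hi2 i]
    simp only [integral_mul_const]
  have hH2 : ContDiff ℝ 1 H := by
    rw [contDiff_iff_contDiffAt]
    intro x0
    set ρ := ‖x0‖ + 1 with hρ
    set g : (Fin n → ℝ) → (Fin n → ℝ) → ℝ := fun p u => χ (G.mul (G.inv p) (-u)) with hg
    have hk : IsCompact ((fun q : (Fin n → ℝ) × (Fin n → ℝ) => -G.mul q.1 q.2) ''
        (Metric.closedBall 0 ρ ×ˢ Metric.closedBall 0 r)) := by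
      apply IsCompact.image ((isCompact_closedBall _ _).prod (isCompact_closedBall _ _))
      exact (G.mul_cont continuous_fst continuous_snd).neg
    have hcv := contDiffOn_convolution_right_with_param (𝕜 := ℝ) (μ := (volume : Measure (Fin n → ℝ)))
      (f := h) (n := 1) (ContinuousLinearMap.mul ℝ ℝ) (g := g) (s := Metric.ball 0 ρ)
      Metric.isOpen_ball hk ?_ hc.locallyIntegrable ?_
    · have h2 : ContDiffAt ℝ 1 (fun x => (fun q : (Fin n → ℝ) × (Fin n → ℝ) =>
        (convolution h (g q.1) (ContinuousLinearMap.mul ℝ ℝ) volume) q.2) (x, 0)) x0 := by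
        apply ContDiffAt.comp (g := (fun q : (Fin n → ℝ) × (Fin n → ℝ) =>
          (convolution h (g q.1) (ContinuousLinearMap.mul ℝ ℝ) volume) q.2)) (f := fun x : Fin n → ℝ => (x, (0 : Fin n → ℝ))) x0
        · apply (hcv (x0, 0) ?_).contDiffAt
          · exact (Metric.isOpen_ball.prod isOpen_univ).mem_nhds (by simp [hρ])
          · simp [hρ]
        · exact (contDiff_id.prodMk contDiff_const).contDiffAt
      have h3 : H = (fun x => (fun q : (Fin n → ℝ) × (Fin n → ℝ) =>
        (convolution h (g q.1) (ContinuousLinearMap.mul ℝ ℝ) volume) q.2) (x, 0)) := by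
        funext x
        simp only [hH, convolution, hg, ContinuousLinearMap.mul_apply', zero_sub, neg_neg]
        rw [G.integral_left x (fun y => h y * χ (G.mul (G.inv x) y))]
        simp only [G.inv_mul_cancel_left]
      rw [h3]; exact h2
    · intro p u hp hu
      by_contra hne
      apply hu
      refine ⟨(p, G.mul (G.inv p) (-u)), ⟨?_, ?_⟩, ?_⟩
      · exact Metric.ball_subset_closedBall hp
      · simp only [Metric.mem_closedBall, dist_zero_right]
        by_contra hlt
        exact hne (hχ0 _ (not_le.mp hlt).le)
      · simp [G.mul_inv_cancel_left]
    · apply ContDiff.contDiffOn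
      show ContDiff ℝ 1 (fun q : (Fin n → ℝ) × (Fin n → ℝ) => χ (G.mul (G.inv q.1) (-q.2)))
      exact χ.contDiff.comp (G.psi_contDiff.comp (contDiff_fst.prodMk contDiff_snd.neg))
  have hfin : h = fun x => (∫ g, χ g)⁻¹ * (H x -
      ∑ i, (∫ g, (h (G.mul (pt i) g) - h (pt i)) * χ g) * l i x) := by
    funext x
    rw [hH1 x]
    field_simp
    ring
  rw [hfin]
  apply contDiff_const.mul
  apply hH2.sub
  apply ContDiff.sum
  intro i _
  exact contDiff_const.mul ((hl i).contDiff.of_le le_top)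

end HomLieGroup


theorem mvp_deriv {n : ℕ} (i : Fin n) (p : MvPolynomial (Fin n ⊕ Fin n) ℝ) :
    ∃ q0 q1 : MvPolynomial (Fin n) ℝ, ∀ x : Fin n → ℝ,
      MvPolynomial.eval (Sum.elim x 0) p = MvPolynomial.eval x q0 ∧
      HasDerivAt (fun t : ℝ => MvPolynomial.eval (Sum.elim x (t • (Pi.single i 1 : Fin n → ℝ))) p)
        (MvPolynomial.eval x q1) 0 := by
  induction p using MvPolynomial.induction_on with
  | C a => exact ⟨MvPolynomial.C a, 0, fun x => ⟨by simp, by simpa using hasDerivAt_const (0:ℝ) a⟩⟩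
  | add p q hp hq =>
    obtain ⟨p0, p1, hp⟩ := hp
    obtain ⟨q0, q1, hq⟩ := hq
    refine ⟨p0 + q0, p1 + q1, fun x => ⟨by simp [(hp x).1, (hq x).1], ?_⟩⟩
    simpa using (hp x).2.fun_add (hq x).2
  | mul_X p j hp =>
    obtain ⟨p0, p1, hp⟩ := hp
    rcases j with j | j
    · refine ⟨p0 * MvPolynomial.X j, p1 * MvPolynomial.X j, fun x => ⟨by simp [(hp x).1], ?_⟩⟩
      simpa using (hp x).2.mul_const (x j)
    · refine ⟨0, p0 * MvPolynomial.C ((Pi.single i 1 : Fin n → ℝ) j), fun x => ⟨by simp, ?_⟩⟩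
      have h1 : HasDerivAt (fun t : ℝ => t * (Pi.single i 1 : Fin n → ℝ) j)
          ((Pi.single i 1 : Fin n → ℝ) j) 0 := by
        simpa using (hasDerivAt_id (0:ℝ)).mul_const ((Pi.single i 1 : Fin n → ℝ) j)
      have h2 := (hp x).2.fun_mul h1
      simp only [zero_smul, zero_mul, mul_zero, zero_add, (hp x).1] at h2
      simpa using h2

namespace HomLieGroup
variable {n : ℕ} (G : HomLieGroup n)

/-- Frame matrix: columns are the left-invariant fields. -/
theorem frame : ∃ (DA : ℕ) (B : (Fin n → ℝ) → Matrix (Fin n) (Fin n) ℝ),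
    (∀ k i, PF DA (fun x => B x k i)) ∧ (∀ x, (B x).det = 1) ∧
    ∀ x i, HasDerivAt (fun t : ℝ => G.mul x (t • (Pi.single i 1 : Fin n → ℝ)))
      (fun k => B x k i) 0 := by
  obtain ⟨p, hp⟩ := G.mul_isPoly
  choose q0 q1 hq using fun (k i : Fin n) => mvp_deriv i (p k)
  refine ⟨∑ k, ∑ i, (q1 k i).totalDegree, fun x => Matrix.of fun k i => MvPolynomial.eval x (q1 k i),
    ?_, ?_, ?_⟩
  · intro k i
    refine ⟨q1 k i, ?_, fun x => rfl⟩
    refine le_trans ?_ (Finset.single_le_sum (f := fun k => ∑ i, (q1 k i).totalDegree)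
      (fun _ _ => Nat.zero_le _) (Finset.mem_univ k))
    exact Finset.single_le_sum (f := fun i => (q1 k i).totalDegree)
      (fun _ _ => Nat.zero_le _) (Finset.mem_univ i)
  · intro x
    obtain ⟨T, hT1, hT⟩ := G.leftT_hasFDeriv x 0
    have : (Matrix.of fun k i => MvPolynomial.eval x (q1 k i)) =
        LinearMap.toMatrix' (T : (Fin n → ℝ) →ₗ[ℝ] (Fin n → ℝ)) := by
      ext k i
      rw [LinearMap.toMatrix'_apply]
      have h1 : HasDerivAt (fun t : ℝ => t • (Pi.single i 1 : Fin n → ℝ)) (Pi.single i 1) 0 := by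
        simpa using (hasDerivAt_id (0:ℝ)).smul_const (Pi.single i 1 : Fin n → ℝ)
      have h2 : HasDerivAt (fun t : ℝ => G.mul x (t • (Pi.single i 1 : Fin n → ℝ)))
          (T (Pi.single i 1)) 0 := by
        have hT' : HasFDerivAt (fun x' => G.mul x x') T ((0:ℝ) • (Pi.single i 1 : Fin n → ℝ)) := by
          simpa using hT
        exact hT'.comp_hasDerivAt 0 h1
      rw [hasDerivAt_pi] at h2
      have h3 := h2 k
      simp only [hp] at h3
      exact ((hq k i x).2.unique h3)
    beta_reduce
    rw [this, LinearMap.det_toMatrix']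
    exact hT1
  · intro x i
    rw [hasDerivAt_pi]
    intro k
    simp only [hp]
    exact (hq k i x).2

theorem PF_det {DA : ℕ} {B : (Fin n → ℝ) → Matrix (Fin n) (Fin n) ℝ}
    (hB : ∀ k i, PF DA (fun x => B x k i)) : PF (n * DA) (fun x => (B x).det) := by
  simp only [Matrix.det_apply']
  apply PF.sum
  intro s _
  apply PF.cmul
  have := PF.prod Finset.univ (fun _ => DA) (f := fun i x => B x (s i) i) (fun i _ => hB _ _)
  simpa using this

theorem PF_adj {DA : ℕ} {B : (Fin n → ℝ) → Matrix (Fin n) (Fin n) ℝ}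
    (hB : ∀ k i, PF DA (fun x => B x k i)) (k i : Fin n) :
    PF (n * DA) (fun x => (B x).adjugate k i) := by
  simp only [Matrix.adjugate_apply]
  apply PF_det
  intro a b
  by_cases h : a = i
  · subst h
    simp only [Matrix.updateRow_self]
    exact PF.const _ _
  · simp only [Matrix.updateRow_ne h]
    exact hB a b

theorem leib_final : ∃ DA : ℕ, ∀ (D m : ℕ) (r : ℝ), 0 < r → ∀ (h : (Fin n → ℝ) → ℝ)
    (pt : Fin m → (Fin n → ℝ)) (l : Fin m → (Fin n → ℝ) → ℝ), (∀ i, PF D (l i)) →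
    ContDiff ℝ 1 h →
    (∀ w, ‖w‖ < r → ∀ x, h (G.mul x w) - h x =
      ∑ i, (h (G.mul (pt i) w) - h (pt i)) * l i x) → PF (D + DA + 1) h := by
  obtain ⟨DA, B, hB, hdet, hder⟩ := G.frame
  refine ⟨n * DA, ?_⟩
  intro D m r hr h pt l hl hC hN
  have hdiff : Differentiable ℝ h := hC.differentiable (by norm_num)
  set Y : Fin n → (Fin n → ℝ) → ℝ := fun i x => fderiv ℝ h x (fun k => B x k i) with hY
  have hYd : ∀ i x, HasDerivAt (fun t : ℝ => h (G.mul x (t • (Pi.single i 1 : Fin n → ℝ))))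
      (Y i x) 0 := by
    intro i x
    have h1 : HasFDerivAt h (fderiv ℝ h x) (G.mul x ((0:ℝ) • (Pi.single i 1 : Fin n → ℝ))) := by
      rw [zero_smul, G.mul_zero]; exact (hdiff x).hasFDerivAt
    exact h1.comp_hasDerivAt 0 (hder x i)
  have hYP : ∀ i, PF D (Y i) := by
    intro i
    have : Y i = fun x => ∑ j, Y i (pt j) * l j x := by
      funext x
      have h1 : HasDerivAt (fun t : ℝ => ∑ j, (h (G.mul (pt j) (t • (Pi.single i 1 : Fin n → ℝ)))
          - h (pt j)) * l j x) (∑ j, Y i (pt j) * l j x) 0 := by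
        apply HasDerivAt.fun_sum
        intro j _
        exact ((hYd i (pt j)).sub_const _).mul_const _
      have h2 := (hYd i x).sub_const (h x)
      have h3 : ∀ᶠ t : ℝ in nhds 0, ‖t • (Pi.single i 1 : Fin n → ℝ)‖ < r := by
        have : Tendsto (fun t : ℝ => ‖t • (Pi.single i 1 : Fin n → ℝ)‖) (nhds 0) (nhds 0) := by
          have hc : Continuous (fun t : ℝ => ‖t • (Pi.single i 1 : Fin n → ℝ)‖) := by fun_prop
          simpa using hc.tendsto 0
        exact this.eventually (gt_mem_nhds hr)
      have h4 := h1.congr_of_eventuallyEq (h3.mono fun t ht => hN _ ht x)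
      exact h2.unique h4
    rw [this]
    exact PF.sum _ fun j _ => (hl j).cmul _
  apply PF.antideriv hdiff
  intro j
  have hform : (fun x => fderiv ℝ h x (Pi.single j 1)) =
      fun x => ∑ i, Y i x * (B x).adjugate i j := by
    funext x
    have h1 : B x * (B x).adjugate = 1 := by rw [Matrix.mul_adjugate, hdet, one_smul]
    have h2 : (Pi.single j 1 : Fin n → ℝ) = ∑ i, (B x).adjugate i j • (fun k => B x k i) := by
      ext k
      have h3 := congrFun (congrFun h1 k) j
      rw [Matrix.mul_apply] at h3
      simp only [Finset.sum_apply, Pi.smul_apply, smul_eq_mul]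
      rw [Pi.single_apply]
      rw [Matrix.one_apply] at h3
      rw [← h3]
      exact Finset.sum_congr rfl fun i _ => mul_comm _ _
    rw [h2, map_sum]
    refine Finset.sum_congr rfl fun i _ => ?_
    rw [map_smul, smul_eq_mul, mul_comm]
  rw [hform]
  exact PF.sum _ fun i _ => (hYP i).mul (PF_adj hB i j)

theorem leib_poly (d : ℕ) : ∃ D : ℕ, ∀ h : (Fin n → ℝ) → ℝ, G.IsLeibman d h →
    (∃ r : ℝ, 0 < r ∧ ∃ M : ℝ, ∀ x, ‖x‖ < r → |h x| ≤ M) → PF D h := by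
  induction d with
  | zero =>
    refine ⟨0, fun h hh _ => ?_⟩
    have : h = fun _ => h 0 := funext fun x => G.leib_zero hh x
    rw [this]; exact PF.const _ _
  | succ d ih =>
    obtain ⟨D, hD⟩ := ih
    obtain ⟨DA, hDA⟩ := G.leib_final
    refine ⟨D + DA + 1, ?_⟩
    rintro h hh ⟨r0, hr0, M, hM⟩
    rw [leib_succ] at hh
    have hcont : Continuous fun q : (Fin n → ℝ) × (Fin n → ℝ) => G.mul q.1 q.2 :=
      G.mul_cont continuous_fst continuous_snd
    have h1 : {q : (Fin n → ℝ) × (Fin n → ℝ) | ‖G.mul q.1 q.2‖ < r0} ∈ nhds (0, 0) := by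
      apply (isOpen_lt hcont.norm continuous_const).mem_nhds
      simpa [G.mul_zero] using hr0
    obtain ⟨r1, hr1, hb⟩ := Metric.mem_nhds_iff.mp h1
    set r := min r0 r1 with hr
    have hrp : 0 < r := lt_min hr0 hr1
    have hk : ∀ x w, ‖x‖ < r → ‖w‖ < r → |h (G.mul x w) - h x| ≤ 2 * M := by
      intro x w hx hw
      have h2 : (x, w) ∈ Metric.ball ((0, 0) : (Fin n → ℝ) × (Fin n → ℝ)) r1 := by
        rw [Metric.mem_ball, Prod.dist_eq]
        simp only [dist_zero_right]
        exact max_lt (hx.trans_le (min_le_right _ _)) (hw.trans_le (min_le_right _ _))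
      have h3 := hM _ (hb h2)
      have h4 := hM x (hx.trans_le (min_le_left _ _))
      have h5 := abs_sub (h (G.mul x w)) (h x)
      linarith
    have hP : ∀ w, ‖w‖ < r → PF D (fun x => h (G.mul x w) - h x) := fun w hw =>
      hD _ (hh w) ⟨r, hrp, 2 * M, fun x hx => hk x w hx hw⟩
    obtain ⟨m, t, l, ht, hl, hi⟩ := PF.interp (n := n) D (r/2) (by positivity)
    have hN : ∀ w, ‖w‖ < r → ∀ x, h (G.mul x w) - h x =
      ∑ i, (h (G.mul (PF.gam D (r/2) (t i)) w) - h (PF.gam D (r/2) (t i))) * l i x :=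
      fun w hw x => hi _ (hP w hw) x
    have hpt : ∀ i, ‖PF.gam (n := n) D (r/2) (t i)‖ < r := fun i =>
      (PF.gam_norm D (r/2) (t i) (by positivity) (ht i)).trans_lt (by linarith)
    have hc := G.leib_cont hrp hl (fun w hw i => hk _ w (hpt i) hw) hN
    have hC := G.leib_C1 hrp hl hc hN
    exact hDA D _ r hrp h _ l hl hC hN

end HomLieGroup


theorem cball_integral {n : ℕ} {ρ C : ℝ} {F : (Fin n → ℝ) → ℂ}
    (h0 : ∀ x, ρ < ‖x‖ → F x = 0) (hC : ∀ x, ‖F x‖ ≤ C) :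
    ‖∫ x, F x‖ ≤ C * (volume : Measure (Fin n → ℝ)).real (Metric.closedBall 0 ρ) := by
  rw [← setIntegral_eq_integral_of_forall_compl_eq_zero (s := Metric.closedBall 0 ρ)
    (fun x hx => h0 x (by simpa using hx))]
  exact norm_setIntegral_le_of_norm_le_const (isCompact_closedBall _ _).measure_lt_top
    fun x _ => hC x

theorem osc_main (n D : ℕ) (hD : 1 ≤ D) (α K B0 : ℝ) (hα : 0 < α) (hK : 0 < K) (hB0 : 1 ≤ B0) :
    ∃ ε C : ℝ, 0 < ε ∧ 0 < C ∧ ∀ (h : (Fin n → ℝ) → ℝ) (ψ : (Fin n → ℝ) → ℂ) (A M : ℝ),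
      PF D h → Continuous ψ → 0 ≤ A → 0 ≤ M → (∀ x, B0 < ‖x‖ → ψ x = 0) →
      (∀ x, ‖ψ x‖ ≤ A) → (∀ x y, ‖ψ x - ψ y‖ ≤ A * K * ‖x - y‖ ^ α) →
      (∃ p q : Fin n → ℝ, ‖p‖ ≤ B0 ∧ ‖q‖ ≤ B0 ∧ M / 2 ≤ |h p - h q|) →
      ‖∫ x, expi (h x) * ψ x‖ ≤ C * A * (1 + M) ^ (-ε) := by
  obtain ⟨C, c, hC, hc, hosc⟩ := PF.osc_curve n D
  set V := (volume : Measure (Fin n → ℝ)).real (Metric.closedBall 0 (B0 + 1)) with hV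
  have hV0 : 0 ≤ V := measureReal_nonneg
  set b : ℝ := 1 / (4 * (2 * B0) ^ D) with hb
  have hB0p : 0 < B0 := by linarith
  have hb0 : 0 < b := by positivity
  have hb1 : b ≤ 1 := by
    rw [hb, div_le_one (by positivity)]
    have : 1 ≤ (2 * B0) ^ D := one_le_pow₀ (by linarith)
    linarith
  have hD0 : (0:ℝ) < D := by exact_mod_cast hD
  refine ⟨min (c/2) (α / (2 * D)), K * V + C * V * b ^ (-c) + 1, lt_min (by positivity)
    (by positivity), by positivity, ?_⟩
  intro h ψ A M hh hψ hA hM hsupp hψA hψK hpq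
  set r : ℝ := (1 + M) ^ (-(1 / (2 * (D:ℝ)))) with hr
  have h1M : 1 ≤ 1 + M := by linarith
  have h1Mp : 0 < 1 + M := by linarith
  have hr0 : 0 < r := Real.rpow_pos_of_pos h1Mp _
  have hr1 : r ≤ 1 := Real.rpow_le_one_of_one_le_of_nonpos h1M (by
    rw [neg_nonpos]; positivity)
  have hrD : r ^ D = (1 + M) ^ (-(1/2) : ℝ) := by
    rw [hr, ← Real.rpow_natCast, ← Real.rpow_mul h1Mp.le]
    congr 1
    field_simp
  have hrα : r ^ α = (1 + M) ^ (-(α / (2 * D))) := by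
    rw [hr, ← Real.rpow_mul h1Mp.le]
    congr 1
    field_simp
  have hcs : HasCompactSupport ψ := by
    apply HasCompactSupport.of_support_subset_isCompact (isCompact_closedBall (0 : Fin n → ℝ) B0)
    intro x hx
    by_contra hne
    exact hx (hsupp x (by simpa using hne))
  have hψi : Integrable ψ := hψ.integrable_of_hasCompactSupport hcs
  have hhc := hh.continuous
  have hFc : Continuous fun x => expi (h x) * ψ x := (expi_cont.comp hhc).mul hψ
  set I := ∫ x, expi (h x) * ψ x with hI
  set γ : ℝ → (Fin n → ℝ) := fun t => PF.gam D r t with hγ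
  have hγc : Continuous γ := PF.gam_cont D r
  have hγn : ∀ t ∈ Icc (0:ℝ) 1, ‖γ t‖ ≤ r := fun t ht => PF.gam_norm D r t hr0.le ht
  set J : ℝ → ℂ := fun t => ∫ x, expi (h (x + γ t)) * ψ x with hJ
  -- integrability on the product
  have hprod : Integrable (Function.uncurry fun (t : ℝ) (x : Fin n → ℝ) =>
      expi (h (x + γ t)) * ψ x) ((volume.restrict (Set.uIoc (0:ℝ) 1)).prod volume) := by
    have hfm : IsFiniteMeasure (volume.restrict (Set.uIoc (0:ℝ) 1)) := by
      rw [Set.uIoc_of_le zero_le_one]; infer_instance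
    have h1 : Integrable (fun q : ℝ × (Fin n → ℝ) => (1:ℂ) * ψ q.2)
        ((volume.restrict (Set.uIoc (0:ℝ) 1)).prod volume) :=
      Integrable.mul_prod (f := fun _ : ℝ => (1:ℂ)) (integrable_const _) hψi
    have h2 := h1.bdd_mul (c := 1) (f := fun q : ℝ × (Fin n → ℝ) => expi (h (q.2 + γ q.1)))
      (by
        apply Continuous.aestronglyMeasurable
        exact expi_cont.comp (hhc.comp (continuous_snd.add (hγc.comp continuous_fst))))
      (Eventually.of_forall fun q => by rw [expi_norm])
    simpa [Function.uncurry_def] using h2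
  have hJi : IntervalIntegrable J volume 0 1 := by
    have h3 := hprod.integral_prod_left
    rw [Set.uIoc_of_le zero_le_one] at h3
    rw [intervalIntegrable_iff_integrableOn_Ioc_of_le zero_le_one]
    exact h3
  have hIJ : ∀ t ∈ Icc (0:ℝ) 1, ‖I - J t‖ ≤ A * K * r ^ α * V := by
    intro t ht
    have h1 : I = ∫ x, expi (h (x + γ t)) * ψ (x + γ t) := by
      rw [hI]
      exact (integral_add_right_eq_self (μ := (volume : Measure (Fin n → ℝ)))
        (fun x => expi (h x) * ψ x) (γ t)).symm
    have hc1 : Continuous fun x => expi (h (x + γ t)) :=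
      expi_cont.comp (hhc.comp (continuous_id.add continuous_const))
    have hi1 : Integrable fun x => expi (h (x + γ t)) * ψ (x + γ t) := by
      have : Integrable fun x => expi (h x) * ψ x :=
        hFc.integrable_of_hasCompactSupport hcs.mul_left
      exact this.comp_add_right (γ t)
    have hi2 : Integrable fun x => expi (h (x + γ t)) * ψ x :=
      (hc1.mul hψ).integrable_of_hasCompactSupport hcs.mul_left
    have h2 : I - J t = ∫ x, expi (h (x + γ t)) * (ψ (x + γ t) - ψ x) := by
      rw [h1, hJ]
      rw [← integral_sub hi1 hi2]
      congr 1
      funext x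
      ring
    rw [h2]
    apply cball_integral
    · intro x hx
      have h3 := hγn t ht
      have h4 : ‖x‖ ≤ ‖x + γ t‖ + ‖γ t‖ := by
        have := norm_sub_le (x + γ t) (γ t)
        rwa [add_sub_cancel_right] at this
      rw [hsupp x (by linarith), hsupp (x + γ t) (by linarith)]
      simp
    · intro x
      rw [norm_mul, expi_norm, one_mul]
      refine (hψK _ _).trans ?_
      rw [add_sub_cancel_left]
      gcongr
      exact hγn t ht
  have hI2 : ‖I - ∫ t in (0:ℝ)..1, J t‖ ≤ A * K * r ^ α * V := by
    have h1 : I - ∫ t in (0:ℝ)..1, J t = ∫ t in (0:ℝ)..1, (I - J t) := by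
      rw [intervalIntegral.integral_sub (by simp) hJi]
      simp
    rw [h1]
    have h2 := intervalIntegral.norm_integral_le_of_norm_le_const (a := 0) (b := 1)
      (f := fun t => I - J t) (C := A * K * r ^ α * V) (fun t ht => hIJ t (by
        rw [Set.uIoc_of_le zero_le_one] at ht
        exact ⟨ht.1.le, ht.2⟩))
    simpa using h2
  have hJ2 : ‖∫ t in (0:ℝ)..1, J t‖ ≤ A * (C * (b * (1 + M) ^ (1/2 : ℝ)) ^ (-c)) * V := by
    have h1 : ∫ t in (0:ℝ)..1, J t = ∫ x, ∫ t in (0:ℝ)..1, expi (h (x + γ t)) * ψ x := by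
      exact intervalIntegral_integral_swap hprod
    rw [h1]
    apply cball_integral
    · intro x hx
      rw [hsupp x (by linarith)]
      simp
    · intro x
      by_cases hx : ‖x‖ ≤ B0
      swap
      · rw [hsupp x (not_le.mp hx)]
        simp only [mul_zero, intervalIntegral.integral_zero, norm_zero]
        positivity
      rw [intervalIntegral.integral_mul_const, norm_mul, mul_comm]
      apply mul_le_mul (hψA x) _ (norm_nonneg _) hA
      obtain ⟨y', hy', hM4⟩ : ∃ y' : Fin n → ℝ, ‖y'‖ ≤ B0 ∧ M / 4 ≤ |h y' - h x| := by
        obtain ⟨p, q, hp, hq, hpq⟩ := hpq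
        by_contra hcon
        push Not at hcon
        have h3 := hcon p hp
        have h4 := hcon q hq
        have h5 := abs_sub (h p - h x) (h q - h x)
        rw [sub_sub_sub_cancel_right] at h5
        linarith
      have hk := hosc (fun u => h (x + r • u)) (hh.affine x r) (2 * B0 / r)
        (by rw [le_div_iff₀ hr0]; linarith) (r⁻¹ • (y' - x)) (by
          rw [norm_smul, norm_inv, Real.norm_of_nonneg hr0.le, div_eq_inv_mul]
          have := norm_sub_le y' x
          gcongr
          linarith)
      simp only [smul_inv_smul₀ hr0.ne', add_sub_cancel, smul_zero, add_zero,
        ← PF.gam_smul] at hk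
      refine hk.trans ?_
      apply mul_le_mul_of_nonneg_left _ hC.le
      apply Real.rpow_le_rpow_of_nonpos (by positivity) _ (by linarith)
      have h6 : b * (M * r ^ D) ≤ |h y' - h x| / (2 * B0 / r) ^ D := by
        have : b * (M * r ^ D) = (M / 4) / (2 * B0 / r) ^ D := by
          rw [hb, div_pow]
          field_simp
        rw [this]
        gcongr
      refine le_trans ?_ (add_le_add_right h6 1)
      rw [hrD]
      have h7 : (1 + M) ^ (1/2 : ℝ) = (1 + M) * (1 + M) ^ (-(1/2) : ℝ) := by
        nth_rewrite 2 [← Real.rpow_one (1 + M)]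
        rw [← Real.rpow_add h1Mp]
        norm_num
      have h8 : (1 + M) ^ (-(1/2) : ℝ) ≤ 1 :=
        Real.rpow_le_one_of_one_le_of_nonpos h1M (by norm_num)
      have h9 : 0 < (1 + M) ^ (-(1/2) : ℝ) := Real.rpow_pos_of_pos h1Mp _
      rw [h7]
      nlinarith
  have hfin : ‖I‖ ≤ A * K * r ^ α * V + A * (C * (b * (1 + M) ^ (1/2 : ℝ)) ^ (-c)) * V := by
    have := norm_add_le (I - ∫ t in (0:ℝ)..1, J t) (∫ t in (0:ℝ)..1, J t)
    rw [sub_add_cancel] at this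
    linarith
  set E := (1 + M) ^ (-(min (c/2) (α / (2 * D)))) with hE
  have hE0 : 0 < E := Real.rpow_pos_of_pos h1Mp _
  have e1 : r ^ α ≤ E := by
    rw [hrα]
    exact Real.rpow_le_rpow_of_exponent_le h1M (neg_le_neg (min_le_right _ _))
  have e2 : (b * (1 + M) ^ (1/2 : ℝ)) ^ (-c) ≤ b ^ (-c) * E := by
    rw [Real.mul_rpow hb0.le (by positivity), ← Real.rpow_mul h1Mp.le]
    apply mul_le_mul_of_nonneg_left _ (by positivity)
    apply Real.rpow_le_rpow_of_exponent_le h1M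
    have := min_le_left (c/2) (α / (2 * D))
    linarith
  have f1 : A * K * r ^ α * V ≤ A * K * E * V := by gcongr
  have f2 : A * (C * (b * (1 + M) ^ (1/2 : ℝ)) ^ (-c)) * V ≤ A * (C * (b ^ (-c) * E)) * V := by
    gcongr
  have f3 : 0 ≤ A * E := by positivity
  have f4 : (K * V + C * V * b ^ (-c) + 1) * A * E =
      A * K * E * V + A * (C * (b ^ (-c) * E)) * V + A * E := by ring
  rw [f4]
  linarith


theorem dil_dil {n : ℕ} (σ : Fin n → ℝ) {a b : ℝ} (ha : 0 ≤ a) (hb : 0 ≤ b) (x : Fin n → ℝ) :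
    dil σ a (dil σ b x) = dil σ (a * b) x := by
  ext i
  simp only [dil]
  rw [Real.mul_rpow ha hb, _root_.mul_assoc]

theorem dil_one {n : ℕ} (σ : Fin n → ℝ) (x : Fin n → ℝ) : dil σ 1 x = x := by
  ext i
  simp [dil]

theorem dil_cont {n : ℕ} (σ : Fin n → ℝ) (l : ℝ) : Continuous (dil σ l) := by
  have : dil σ l = dilL σ l := by funext x; rw [dilL_apply]
  rw [this]; exact (dilL σ l).continuous

namespace HomLieGroup
variable {n : ℕ} (G : HomLieGroup n)

/-- The Euclidean ball `U_ε`. -/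
def Ueps : Set (Fin n → ℝ) := {x | ∑ j, x j ^ 2 < G.eps ^ 2}

theorem Ueps_open : IsOpen G.Ueps :=
  isOpen_lt (by fun_prop) continuous_const

theorem zero_mem_Ueps : (0 : Fin n → ℝ) ∈ G.Ueps := by
  simp [Ueps, G.eps_pos]

theorem Ueps_norm {x : Fin n → ℝ} (hx : x ∈ G.Ueps) : ‖x‖ ≤ G.eps := by
  rw [pi_norm_le_iff_of_nonneg G.eps_pos.le]
  intro i
  rw [Real.norm_eq_abs]
  apply abs_le_of_sq_le_sq _ G.eps_pos.le
  exact (Finset.single_le_sum (f := fun j => x j ^ 2) (fun j _ => sq_nonneg _)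
    (Finset.mem_univ i)).trans (le_of_lt hx)

theorem rho_le_of {x y : Fin n → ℝ} {l : ℝ} (hl : 0 < l)
    (h : dil G.σ l⁻¹ (G.mul x (G.inv y)) ∈ G.Ueps) : G.rho x y ≤ l :=
  csInf_le ⟨0, fun _ h => h.1.le⟩ ⟨hl, h⟩

theorem rho_lt_iff {x y : Fin n → ℝ} {R : ℝ} (hR : 0 < R) :
    G.rho x y < R ↔ dil G.σ R⁻¹ (G.mul x (G.inv y)) ∈ G.Ueps := by
  set v := G.mul x (G.inv y) with hv
  have hcont : ∀ l : ℝ, 0 < l → ContinuousAt (fun l : ℝ => ∑ j, (dil G.σ l⁻¹ v j) ^ 2) l := by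
    intro l hl
    simp only [dil]
    refine tendsto_finsetSum _ fun j _ => ?_
    refine ContinuousAt.pow (ContinuousAt.mul ?_ continuousAt_const) 2
    exact (continuousAt_inv₀ hl.ne').rpow_const (Or.inl (inv_pos.mpr hl).ne')
  constructor
  · intro h
    have hne : {l : ℝ | 0 < l ∧ ∑ j, (dil G.σ l⁻¹ v j) ^ 2 < G.eps ^ 2}.Nonempty := by
      have h1 : Tendsto (fun l : ℝ => l⁻¹) atTop (nhdsWithin 0 (Ioi 0)) := tendsto_inv_atTop_nhdsGT_zero
      have h2 := (dil_tendsto G.σ G.one_le_σ v).comp h1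
      have h3 := h2.eventually (G.Ueps_open.mem_nhds G.zero_mem_Ueps)
      obtain ⟨l, hl1, hl2⟩ := (h3.and (eventually_gt_atTop 0)).exists
      exact ⟨l, hl2, hl1⟩
    obtain ⟨l, ⟨hl0, hl⟩, hlR⟩ := exists_lt_of_csInf_lt hne h
    refine lt_of_le_of_lt (Finset.sum_le_sum fun j _ => ?_) hl
    simp only [dil, mul_pow]
    have h4 : R⁻¹ ^ G.σ j ≤ l⁻¹ ^ G.σ j :=
      Real.rpow_le_rpow (by positivity) (by gcongr) (by linarith [G.one_le_σ j])
    have h5 : 0 ≤ R⁻¹ ^ G.σ j := by positivity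
    gcongr
  · intro h
    have h1 : ∀ᶠ l in nhds R, ∑ j, (dil G.σ l⁻¹ v j) ^ 2 < G.eps ^ 2 :=
      (hcont R hR).eventually (gt_mem_nhds h)
    have h2 : ∀ᶠ l in nhdsWithin R (Iio R), ∑ j, (dil G.σ l⁻¹ v j) ^ 2 < G.eps ^ 2 :=
      h1.filter_mono nhdsWithin_le_nhds
    have h3 : ∀ᶠ l in nhdsWithin R (Iio R), 0 < l :=
      (lt_mem_nhds hR).filter_mono nhdsWithin_le_nhds
    obtain ⟨l, ⟨hl1, hl2⟩, hl3⟩ := ((h2.and h3).and self_mem_nhdsWithin).exists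
    exact (G.rho_le_of hl2 hl1).trans_lt hl3

/-- The map `x ↦ δ_R(x) ∘ z`. -/
def TT (z : Fin n → ℝ) (R : ℝ) (x : Fin n → ℝ) : Fin n → ℝ := G.mul (dil G.σ R x) z

theorem TT_inv (z : Fin n → ℝ) {R : ℝ} (hR : 0 < R) (x : Fin n → ℝ) :
    G.TT z R (dil G.σ R⁻¹ (G.mul x (G.inv z))) = x := by
  rw [TT, dil_dil _ hR.le (by positivity), mul_inv_cancel₀ hR.ne', dil_one, G.inv_mul_cancel_right]

theorem inv_TT (z : Fin n → ℝ) {R : ℝ} (hR : 0 < R) (x : Fin n → ℝ) :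
    dil G.σ R⁻¹ (G.mul (G.TT z R x) (G.inv z)) = x := by
  rw [TT, G.mul_inv_cancel_right, dil_dil _ (by positivity) hR.le, inv_mul_cancel₀ hR.ne', dil_one]

theorem TT_cont (z : Fin n → ℝ) (R : ℝ) : Continuous (G.TT z R) :=
  G.mul_cont (dil_cont _ _) continuous_const

theorem TT_mem (hρ : G.IsMetric) (z : Fin n → ℝ) {R : ℝ} (hR : 0 < R) (x : Fin n → ℝ) :
    G.TT z R x ∈ G.ball z R ↔ x ∈ G.Ueps := by
  show G.rho z (G.TT z R x) < R ↔ _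
  rw [hρ.2.2.1, G.rho_lt_iff hR, G.inv_TT z hR]

theorem TT_image (hρ : G.IsMetric) (z : Fin n → ℝ) {R : ℝ} (hR : 0 < R) :
    G.TT z R '' G.Ueps = G.ball z R := by
  ext x
  constructor
  · rintro ⟨y, hy, rfl⟩
    exact (G.TT_mem hρ z hR y).mpr hy
  · intro hx
    refine ⟨dil G.σ R⁻¹ (G.mul x (G.inv z)), ?_, G.TT_inv z hR x⟩
    rw [← G.TT_mem hρ z hR, G.TT_inv z hR]
    exact hx

theorem TT_leib (z : Fin n → ℝ) {R : ℝ} (hR : 0 < R) {d : ℕ} {f : (Fin n → ℝ) → ℝ}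
    (hf : G.IsLeibman d f) : G.IsLeibman d (fun x => f (G.TT z R x)) := by
  apply G.leib_comp (θ := fun w => G.mul (G.inv z) (G.mul (dil G.σ R w) z)) _ hf
  intro x w
  simp only [TT]
  rw [G.dil_mul R hR, G.mul_assoc (dil G.σ R x) z, G.mul_inv_cancel_left, G.mul_assoc]

theorem TT_integral (hρ : G.IsMetric) (z : Fin n → ℝ) {R : ℝ} (hR : 0 < R)
    (F : (Fin n → ℝ) → ℂ) :
    ∫ x in G.ball z R, F x = ((R ^ G.homDim : ℝ) : ℂ) * ∫ x in G.Ueps, F (G.TT z R x) := by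
  choose T hT1 hT using G.rightT_hasFDeriv z
  have hd : ∀ x, HasFDerivAt (G.TT z R) ((T (dilL G.σ R x)).comp (dilL G.σ R)) x := by
    intro x
    have h1 := (hT (dilL G.σ R x)).comp x (dilL G.σ R).hasFDerivAt
    have h2 : (fun x' => G.mul x' z) ∘ (dilL G.σ R) = G.TT z R := by
      funext y
      simp [TT, dilL_apply]
    rwa [h2] at h1
  have hdet : ∀ x, ((T (dilL G.σ R x)).comp (dilL G.σ R)).det = R ^ G.homDim := by
    intro x
    have h1 : ((T (dilL G.σ R x)).comp (dilL G.σ R)).det =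
        (T (dilL G.σ R x)).det * (dilL G.σ R).det := by
      simp only [ContinuousLinearMap.det, ContinuousLinearMap.toLinearMap_comp, LinearMap.det_comp]
    rw [h1, hT1, one_mul, dilL_det, homDim, Real.rpow_sum_of_pos hR]
  have key := integral_image_eq_integral_abs_det_fderiv_smul (volume : Measure (Fin n → ℝ))
    G.Ueps_open.measurableSet (fun x _ => (hd x).hasFDerivWithinAt)
    (fun a _ b _ hab => by
      have := congrArg (fun u => dil G.σ R⁻¹ (G.mul u (G.inv z))) hab
      simpa only [G.inv_TT z hR] using this) F
  rw [G.TT_image hρ z hR] at key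
  rw [key]
  simp only [hdet]
  rw [abs_of_nonneg (by positivity), integral_smul]
  simp

theorem TT_rho : ∃ α K : ℝ, 0 < α ∧ 0 < K ∧ ∀ (z : Fin n → ℝ) (R : ℝ), 0 < R →
    ∀ x y, x ≠ y → ‖G.mul x (G.inv y)‖ ≤ 1 →
    G.rho (G.TT z R x) (G.TT z R y) ≤ R * (K * ‖G.mul x (G.inv y)‖ ^ α) := by
  set S : ℝ := ∑ i, G.σ i + 1 with hS
  have hσ0 : ∀ i, 0 ≤ G.σ i := fun i => by linarith [G.one_le_σ i]
  have hσS : ∀ i, G.σ i ≤ S := fun i => by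
    have := Finset.single_le_sum (f := G.σ) (fun i _ => hσ0 i) (Finset.mem_univ i)
    linarith
  have hS0 : 0 < S := by
    have := Finset.sum_nonneg (s := Finset.univ) (f := G.σ) (fun i _ => hσ0 i)
    linarith
  obtain ⟨K, hK1, hK⟩ : ∃ K : ℝ, 1 ≤ K ∧ (n:ℝ) / K ^ 2 < G.eps ^ 2 := by
    have he := G.eps_pos
    obtain ⟨N, hN⟩ := exists_nat_gt ((n:ℝ) / G.eps ^ 2)
    refine ⟨N + 1, by linarith [N.cast_nonneg (α := ℝ)], ?_⟩
    rw [div_lt_iff₀ (by positivity)] at hN ⊢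
    have : (N:ℝ) ≤ (N+1)^2 := by nlinarith [N.cast_nonneg (α := ℝ)]
    nlinarith [sq_pos_of_pos he]
  refine ⟨1 / S, K, by positivity, by linarith, ?_⟩
  intro z R hR x y hxy hw
  set w := G.mul x (G.inv y) with hwdef
  have hw0 : 0 < ‖w‖ := by
    rw [norm_pos_iff]
    intro h0
    apply hxy
    have := G.inv_mul_cancel_right x y
    rw [← hwdef, h0, G.zero_mul] at this
    exact this.symm
  have hKp : 0 < K := by linarith
  set s := K * ‖w‖ ^ (1 / S) with hs
  have hs0 : 0 < s := by positivity
  apply G.rho_le_of (by positivity)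
  have h1 : G.mul (G.TT z R x) (G.inv (G.TT z R y)) = dil G.σ R w := by
    rw [TT, TT, G.inv_mul_rev, G.mul_assoc, G.mul_inv_cancel_left, G.inv_dil hR, ← G.dil_mul R hR]
  rw [h1, dil_dil _ (by positivity) hR.le]
  have h2 : (R * s)⁻¹ * R = s⁻¹ := by field_simp
  rw [h2]
  show ∑ j, (dil G.σ s⁻¹ w j) ^ 2 < G.eps ^ 2
  have h3 : ∀ j, (dil G.σ s⁻¹ w j) ^ 2 ≤ (K⁻¹) ^ 2 := by
    intro j
    apply sq_le_sq'
    all_goals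
      have h4 : |dil G.σ s⁻¹ w j| ≤ K⁻¹ := by
        simp only [dil]
        rw [abs_mul, abs_of_nonneg (by positivity)]
        have h5 : |w j| ≤ ‖w‖ := norm_le_pi_norm w j
        have h6 : s⁻¹ ^ G.σ j = K⁻¹ ^ G.σ j * (‖w‖ ^ (G.σ j / S))⁻¹ := by
          rw [hs, _root_.mul_inv, Real.mul_rpow (by positivity) (by positivity),
            Real.inv_rpow (by positivity : (0:ℝ) ≤ ‖w‖ ^ (1/S)), ← Real.rpow_mul hw0.le]
          congr 3
          ring
        have h7 : ‖w‖ ≤ ‖w‖ ^ (G.σ j / S) := by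
          conv_lhs => rw [← Real.rpow_one ‖w‖]
          apply Real.rpow_le_rpow_of_exponent_ge hw0 hw
          rw [div_le_one hS0]; exact hσS j
        have h8 : K⁻¹ ^ G.σ j ≤ K⁻¹ := by
          conv_rhs => rw [← Real.rpow_one K⁻¹]
          exact Real.rpow_le_rpow_of_exponent_ge (by positivity) (inv_le_one_of_one_le₀ hK1)
            (G.one_le_σ j)
        have h9 : 0 < ‖w‖ ^ (G.σ j / S) := by positivity
        rw [h6, _root_.mul_assoc]
        have h10 : (‖w‖ ^ (G.σ j / S))⁻¹ * |w j| ≤ 1 := by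
          rw [inv_mul_le_iff₀ h9]; linarith
        have h11 : 0 ≤ K⁻¹ ^ G.σ j := by positivity
        have h12 : 0 ≤ (‖w‖ ^ (G.σ j / S))⁻¹ * |w j| := by positivity
        nlinarith
      have h13 := abs_le.mp h4
    · exact h13.1
    · exact h13.2
  have h14 : ∑ j, (dil G.σ s⁻¹ w j) ^ 2 ≤ ∑ _j : Fin n, (K⁻¹) ^ 2 := Finset.sum_le_sum fun j _ => h3 j
  refine lt_of_le_of_lt h14 ?_
  rw [Finset.sum_const, Finset.card_univ, Fintype.card_fin, nsmul_eq_mul, inv_pow, ← div_eq_mul_inv]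
  exact hK

theorem W_lip : ∃ C1 : ℝ, 1 ≤ C1 ∧ ∀ x ∈ G.Ueps, ∀ y ∈ G.Ueps,
    ‖G.mul x (G.inv y)‖ ≤ C1 * ‖x - y‖ := by
  have hW : ContDiff ℝ 1 (fun q : (Fin n → ℝ) × (Fin n → ℝ) => G.mul q.1 (G.inv q.2)) :=
    G.mul_contDiff.comp (contDiff_fst.prodMk (G.inv_contDiff.comp contDiff_snd))
  obtain ⟨K, hK⟩ := hW.contDiffOn.exists_lipschitzOnWith (s := Metric.closedBall 0 G.eps)
    (by norm_num) (convex_closedBall _ _) (isCompact_closedBall _ _)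
  refine ⟨K + 1, by simp, ?_⟩
  intro x hx y hy
  have hm : ∀ a ∈ G.Ueps, ∀ b ∈ G.Ueps, (a, b) ∈ Metric.closedBall
      (0 : (Fin n → ℝ) × (Fin n → ℝ)) G.eps := by
    intro a ha b hb
    rw [mem_closedBall_zero_iff, Prod.norm_def]
    exact max_le (G.Ueps_norm ha) (G.Ueps_norm hb)
  have := hK.dist_le_mul (x, y) (hm x hx y hy) (y, y) (hm y hy y hy)
  simp only [G.mul_inv, dist_zero_right] at this
  rw [Prod.dist_eq, dist_self, max_eq_left dist_nonneg, dist_eq_norm] at this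
  nlinarith [norm_nonneg (x - y)]

theorem phi_cont {φ : (Fin n → ℝ) → ℂ} {L : ℝ} (hL : 0 ≤ L)
    (h : ∀ x y, ‖φ x - φ y‖ ≤ L * G.rho x y) : Continuous φ := by
  rw [Metric.continuous_iff']
  intro x η hη
  have hδ : 0 < η / (L + 1) := by positivity
  have h1 : ∀ᶠ y in nhds x, dil G.σ (η/(L+1))⁻¹ (G.mul y (G.inv x)) ∈ G.Ueps := by
    have hc : Continuous fun y => dil G.σ (η/(L+1))⁻¹ (G.mul y (G.inv x)) :=
      (dil_cont _ _).comp (G.mul_cont continuous_id continuous_const)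
    apply hc.continuousAt.eventually (G.Ueps_open.mem_nhds _)
    beta_reduce
    rw [G.mul_inv, dil_zero]
    exact G.zero_mem_Ueps
  filter_upwards [h1] with y hy
  rw [dist_eq_norm]
  have h2 := (G.rho_lt_iff hδ).mpr hy
  refine (h y x).trans_lt ?_
  have h3 : L * G.rho y x ≤ L * (η / (L+1)) := by gcongr
  have h4 : L * (η / (L+1)) < η := by
    rw [mul_div_assoc', div_lt_iff₀ (by positivity)]
    nlinarith
  linarith

end HomLieGroup


namespace HomLieGroup
variable {n : ℕ} (G : HomLieGroup n)

theorem c01_bounds (hρ : G.IsMetric) {z : Fin n → ℝ} {R : ℝ} (hR : 0 < R)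
    {φ : (Fin n → ℝ) → ℂ} {L : ℝ} (hL : 0 ≤ L) (hφ : ∀ x y, ‖φ x - φ y‖ ≤ L * G.rho x y)
    (hs : Function.support φ ⊆ G.ball z R) :
    0 ≤ c01G G z R φ ∧ (∀ x, ‖φ x‖ ≤ c01G G z R φ) ∧
    ∀ x ∈ G.ball z R, ∀ y ∈ G.ball z R, R * ‖φ x - φ y‖ ≤ c01G G z R φ * G.rho x y := by
  set s1 := (fun x => ‖φ x‖) '' G.ball z R with hs1
  set s2 := (fun q : (Fin n → ℝ) × (Fin n → ℝ) => ‖φ q.1 - φ q.2‖ / G.rho q.1 q.2) ''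
      ((G.ball z R ×ˢ G.ball z R) ∩ {q | q.1 ≠ q.2}) with hs2
  have hb1 : BddAbove s1 := by
    refine ⟨‖φ z‖ + L * R, ?_⟩
    rintro _ ⟨x, hx, rfl⟩
    have h1 : G.rho z x < R := hx
    have h2 := hφ z x
    have h3 := norm_sub_norm_le (φ x) (φ z)
    rw [norm_sub_rev] at h3
    have h4 : L * G.rho z x ≤ L * R := by gcongr
    show ‖φ x‖ ≤ _
    linarith
  have hb2 : BddAbove s2 := by
    refine ⟨L, ?_⟩
    rintro _ ⟨q, hq, rfl⟩
    exact div_le_of_le_mul₀ (hρ.1 _ _) hL (hφ _ _)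
  have h01 : 0 ≤ sSup s1 := Real.sSup_nonneg (by rintro _ ⟨x, hx, rfl⟩; exact norm_nonneg _)
  have h02 : 0 ≤ sSup s2 := Real.sSup_nonneg (by
    rintro _ ⟨q, hq, rfl⟩; exact div_nonneg (norm_nonneg _) (hρ.1 _ _))
  have hA : c01G G z R φ = sSup s1 + R * sSup s2 := rfl
  have hA0 : 0 ≤ c01G G z R φ := by rw [hA]; positivity
  refine ⟨hA0, ?_, ?_⟩
  · intro x
    by_cases hx : x ∈ G.ball z R
    · have : ‖φ x‖ ≤ sSup s1 := le_csSup hb1 ⟨x, hx, rfl⟩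
      have : 0 ≤ R * sSup s2 := by positivity
      rw [hA]; linarith
    · have : φ x = 0 := by
        by_contra hne
        exact hx (hs hne)
      rw [this, norm_zero]; exact hA0
  · intro x hx y hy
    by_cases hxy : x = y
    · subst hxy
      simp only [sub_self, norm_zero, MulZeroClass.mul_zero]
      exact mul_nonneg hA0 (hρ.1 _ _)
    · have hr : 0 < G.rho x y := lt_of_le_of_ne (hρ.1 _ _) fun h =>
        hxy ((hρ.2.1 x y).mp h.symm)
      have h1 : ‖φ x - φ y‖ / G.rho x y ≤ sSup s2 := le_csSup hb2 ⟨(x, y), ⟨⟨hx, hy⟩, hxy⟩, rfl⟩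
      rw [div_le_iff₀ hr] at h1
      rw [hA]
      have h2 : 0 ≤ sSup s1 * G.rho x y := by positivity
      nlinarith

theorem holder (hρ : G.IsMetric) : ∃ α K : ℝ, 0 < α ∧ 0 < K ∧ ∀ (z : Fin n → ℝ) (R : ℝ), 0 < R →
    ∀ (φ : (Fin n → ℝ) → ℂ) (L : ℝ), 0 ≤ L → (∀ x y, ‖φ x - φ y‖ ≤ L * G.rho x y) →
    Function.support φ ⊆ G.ball z R →
    ∀ x y, ‖φ (G.TT z R x) - φ (G.TT z R y)‖ ≤ c01G G z R φ * K * ‖x - y‖ ^ α := by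
  obtain ⟨α, K, hα, hK, hTT⟩ := G.TT_rho
  obtain ⟨C1, hC1, hW⟩ := G.W_lip
  have hC1p : 0 < C1 := by linarith
  refine ⟨α, (K + 2) * C1 ^ α, hα, by positivity, ?_⟩
  intro z R hR φ L hL hφ hs
  obtain ⟨hA0, hA1, hA2⟩ := G.c01_bounds hρ hR hL hφ hs
  set A := c01G G z R φ with hA
  have hUU : ∀ x ∈ G.Ueps, ∀ y ∈ G.Ueps, ‖φ (G.TT z R x) - φ (G.TT z R y)‖ ≤
      A * ((K + 2) * C1 ^ α) * ‖x - y‖ ^ α := by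
    intro x hx y hy
    by_cases hxy : x = y
    · subst hxy
      simp only [sub_self, norm_zero]
      positivity
    have hw := hW x hx y hy
    have hmr : (C1 * ‖x - y‖) ^ α = C1 ^ α * ‖x - y‖ ^ α := Real.mul_rpow hC1p.le (norm_nonneg _)
    have hX : 0 ≤ C1 ^ α * ‖x - y‖ ^ α := by positivity
    have hre : A * ((K + 2) * C1 ^ α) * ‖x - y‖ ^ α =
      A * K * (C1 ^ α * ‖x - y‖ ^ α) + 2 * A * (C1 ^ α * ‖x - y‖ ^ α) := by ring
    rw [hre]
    by_cases h1 : C1 * ‖x - y‖ ≤ 1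
    · have h2 := hTT z R hR x y hxy (hw.trans h1)
      have h3 := hA2 _ ((G.TT_mem hρ z hR x).mpr hx) _ ((G.TT_mem hρ z hR y).mpr hy)
      have h4 : ‖G.mul x (G.inv y)‖ ^ α ≤ C1 ^ α * ‖x - y‖ ^ α := by
        rw [← hmr]; gcongr
      have h5 : R * ‖φ (G.TT z R x) - φ (G.TT z R y)‖ ≤
          R * (A * K * (C1 ^ α * ‖x - y‖ ^ α)) := by
        have h6 : A * G.rho (G.TT z R x) (G.TT z R y) ≤
            A * (R * (K * (C1 ^ α * ‖x - y‖ ^ α))) := by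
          apply mul_le_mul_of_nonneg_left _ hA0
          refine h2.trans ?_
          gcongr
        refine (h3.trans h6).trans (le_of_eq ?_)
        ring
      have h7 := le_of_mul_le_mul_left h5 hR
      have h8 : 0 ≤ 2 * A * (C1 ^ α * ‖x - y‖ ^ α) := by positivity
      linarith
    · have h2 : 1 ≤ C1 ^ α * ‖x - y‖ ^ α := by
        rw [← hmr]
        exact Real.one_le_rpow (not_le.mp h1).le hα.le
      have h3 := norm_sub_le (φ (G.TT z R x)) (φ (G.TT z R y))
      have h4 := hA1 (G.TT z R x)
      have h5 := hA1 (G.TT z R y)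
      have h6 : 0 ≤ A * K * (C1 ^ α * ‖x - y‖ ^ α) := by positivity
      nlinarith
  have hcont : Continuous fun x => φ (G.TT z R x) :=
    (G.phi_cont hL hφ).comp (G.TT_cont z R)
  have hout : ∀ x, x ∉ G.Ueps → φ (G.TT z R x) = 0 := by
    intro x hx
    by_contra hne
    exact hx ((G.TT_mem hρ z hR x).mp (hs hne))
  have hUO : ∀ x ∈ G.Ueps, ∀ y, y ∉ G.Ueps → ‖φ (G.TT z R x) - φ (G.TT z R y)‖ ≤
      A * ((K + 2) * C1 ^ α) * ‖x - y‖ ^ α := by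
    intro x hx y hy
    have hcl : ∀ b ∈ closure G.Ueps, ‖φ (G.TT z R x) - φ (G.TT z R b)‖ ≤
        A * ((K + 2) * C1 ^ α) * ‖x - b‖ ^ α := by
      have hclosed : IsClosed {b | ‖φ (G.TT z R x) - φ (G.TT z R b)‖ ≤
          A * ((K + 2) * C1 ^ α) * ‖x - b‖ ^ α} := by
        apply isClosed_le
        · exact (continuous_const.sub hcont).norm
        · exact continuous_const.mul ((continuous_const.sub continuous_id).norm.rpow_const
            fun _ => Or.inr hα.le)
      exact closure_minimal (hUU x hx) hclosed
    by_cases hyc : y ∈ closure G.Ueps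
    · exact hcl y hyc
    obtain ⟨b, hbs, hbc, hbU⟩ : ∃ b ∈ segment ℝ x y, b ∈ closure G.Ueps ∧ b ∉ G.Ueps := by
      by_contra hcon
      push Not at hcon
      have hpre : IsPreconnected (segment ℝ x y) := (convex_segment x y).isPreconnected
      obtain ⟨b, hb1, hb2, hb3⟩ := hpre G.Ueps (closure G.Ueps)ᶜ G.Ueps_open
        isClosed_closure.isOpen_compl (fun b hb => by
          by_cases hbc : b ∈ closure G.Ueps
          · exact Or.inl (hcon b hb hbc)
          · exact Or.inr hbc)
        ⟨x, left_mem_segment ℝ x y, hx⟩ ⟨y, right_mem_segment ℝ x y, hyc⟩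
      exact hb3 (subset_closure hb2)
    have h1 := hcl b hbc
    rw [hout b hbU] at h1
    rw [hout y hy]
    refine h1.trans ?_
    have h2 : ‖x - b‖ ≤ ‖x - y‖ := by
      rw [segment_eq_image'] at hbs
      obtain ⟨t, ht, rfl⟩ := hbs
      simp only [sub_add_cancel_left, norm_neg, norm_smul]
      rw [Real.norm_of_nonneg ht.1, norm_sub_rev y x]
      exact mul_le_of_le_one_left (norm_nonneg _) ht.2
    gcongr
  intro x y
  by_cases hx : x ∈ G.Ueps
  · by_cases hy : y ∈ G.Ueps
    · exact hUU x hx y hy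
    · exact hUO x hx y hy
  · by_cases hy : y ∈ G.Ueps
    · rw [norm_sub_rev, norm_sub_rev x y]
      exact hUO y hy x hx
    · rw [hout x hx, hout y hy, sub_self, norm_zero]
      positivity

end HomLieGroup


theorem stmt18 {n : ℕ} (G : HomLieGroup n) (hρ : G.IsMetric) (d : ℕ) (hd : 1 ≤ d) :
    ∃ ε : ℝ, 0 < ε ∧ ∃ C : ℝ, 0 < C ∧ ∀ (z : Fin n → ℝ) (R : ℝ), 0 < R →
      ∀ φ : (Fin n → ℝ) → ℂ,
        (∃ L : ℝ, 0 ≤ L ∧ ∀ x y, ‖φ x - φ y‖ ≤ L * G.rho x y) →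
        Function.support φ ⊆ G.ball z R →
        ∀ f g : (Fin n → ℝ) → ℝ,
          G.IsLeibman d f → f 0 = 0 → G.IsLeibman d g → g 0 = 0 →
          ‖∫ x in G.ball z R, expi (f x - g x) * φ x‖ ≤
            C * R ^ G.homDim * c01G G z R φ * (1 + dB (G.ball z R) f g) ^ (-ε) := by
  obtain ⟨D, hD⟩ := G.leib_poly d
  obtain ⟨α, K, hα, hK, hhol⟩ := G.holder hρ
  set B0 : ℝ := G.eps + 1 with hB0
  obtain ⟨ε, C, hε, hC, hosc⟩ := osc_main n (D + 1) (by omega) α K B0 hα hK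
    (by linarith [G.eps_pos])
  set V := (volume : Measure (Fin n → ℝ)).real G.Ueps with hV
  have hV0 : 0 ≤ V := measureReal_nonneg
  refine ⟨ε, hε, C + V, by positivity, ?_⟩
  rintro z R hR φ ⟨L, hL, hφ⟩ hs f g hf _ hg _
  obtain ⟨hA0, hA1, -⟩ := G.c01_bounds hρ hR hL hφ hs
  have hhol' := hhol z R hR φ L hL hφ hs
  set A := c01G G z R φ with hA
  rw [G.TT_integral hρ z hR (fun x => expi (f x - g x) * φ x)]
  set h : (Fin n → ℝ) → ℝ := fun x => f (G.TT z R x) - g (G.TT z R x) with hh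
  set ψ : (Fin n → ℝ) → ℂ := fun x => φ (G.TT z R x) with hψ
  have hRd : 0 < R ^ G.homDim := Real.rpow_pos_of_pos hR _
  rw [norm_mul, Complex.norm_real, Real.norm_of_nonneg hRd.le]
  set M := dB (G.ball z R) f g with hM
  have hM0 : 0 ≤ M := Real.sSup_nonneg (by rintro _ ⟨q, hq, rfl⟩; exact abs_nonneg _)
  have hE0 : 0 < (1 + M) ^ (-ε) := Real.rpow_pos_of_pos (by linarith) _
  suffices hsuf : ‖∫ x in G.Ueps, expi (h x) * ψ x‖ ≤ (C + V) * A * (1 + M) ^ (-ε) by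
    have := mul_le_mul_of_nonneg_left hsuf hRd.le
    refine this.trans (le_of_eq ?_)
    ring
  have hUm : (volume : Measure (Fin n → ℝ)) G.Ueps < ⊤ := by
    refine lt_of_le_of_lt (measure_mono fun x hx => ?_)
      (isCompact_closedBall (0 : Fin n → ℝ) G.eps).measure_lt_top
    simpa using G.Ueps_norm hx
  have htriv : ‖∫ x in G.Ueps, expi (h x) * ψ x‖ ≤ A * V := by
    apply norm_setIntegral_le_of_norm_le_const hUm
    intro x _
    rw [norm_mul, expi_norm, one_mul]
    exact hA1 _
  by_cases hM1 : M = 0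
  · rw [hM1, add_zero, Real.one_rpow, mul_one]
    nlinarith
  have hMp : 0 < M := lt_of_le_of_ne hM0 (Ne.symm hM1)
  set S := (fun q : (Fin n → ℝ) × (Fin n → ℝ) => |f q.1 - f q.2 - g q.1 + g q.2|) ''
    (G.ball z R ×ˢ G.ball z R) with hS
  have hMS : M = sSup S := rfl
  have hbdd : BddAbove S := by
    by_contra hnb
    exact hM1 (hMS.trans (Real.sSup_of_not_bddAbove hnb))
  have hpair : ∀ x ∈ G.Ueps, ∀ y ∈ G.Ueps, |h x - h y| ≤ M := by
    intro x hx y hy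
    rw [hMS]
    refine le_csSup hbdd ⟨(G.TT z R x, G.TT z R y), ⟨(G.TT_mem hρ z hR x).mpr hx,
      (G.TT_mem hρ z hR y).mpr hy⟩, ?_⟩
    simp only [hh]
    congr 1
    ring
  have hPF : PF (D + 1) h := by
    refine (hD h (G.leib_sub (G.TT_leib z hR hf) (G.TT_leib z hR hg)) ?_).mono (Nat.le_succ D)
    obtain ⟨r, hr, hball⟩ := Metric.isOpen_iff.mp G.Ueps_open 0 G.zero_mem_Ueps
    refine ⟨r, hr, M + |h 0|, fun x hx => ?_⟩
    have h1 := hpair x (hball (by simpa using hx)) 0 G.zero_mem_Ueps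
    have h2 := abs_add_le (h x - h 0) (h 0)
    rw [sub_add_cancel] at h2
    linarith
  have hcont : Continuous ψ := (G.phi_cont hL hφ).comp (G.TT_cont z R)
  have hout : ∀ x, x ∉ G.Ueps → ψ x = 0 := by
    intro x hx
    by_contra hne
    exact hx ((G.TT_mem hρ z hR x).mp (hs hne))
  have hpq : ∃ p q : Fin n → ℝ, ‖p‖ ≤ B0 ∧ ‖q‖ ≤ B0 ∧ M / 2 ≤ |h p - h q| := by
    have hne : S.Nonempty := by
      have h0 := (G.TT_mem hρ z hR 0).mpr G.zero_mem_Ueps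
      exact ⟨_, ⟨(G.TT z R 0, G.TT z R 0), ⟨h0, h0⟩, rfl⟩⟩
    obtain ⟨_, ⟨⟨u, v⟩, ⟨hu, hv⟩, rfl⟩, huv⟩ := exists_lt_of_lt_csSup hne
      (show M / 2 < sSup S by rw [← hMS]; linarith)
    rw [← G.TT_image hρ z hR] at hu hv
    obtain ⟨p, hp, hpu⟩ := hu
    obtain ⟨q, hq, hqv⟩ := hv
    simp only at hpu hqv huv
    refine ⟨p, q, by linarith [G.Ueps_norm hp], by linarith [G.Ueps_norm hq], ?_⟩
    have : h p - h q = f u - f v - g u + g v := by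
      simp only [hh, hpu, hqv]; ring
    rw [this]; exact huv.le
  have hmain := hosc h ψ A M hPF hcont hA0 hM0 (fun x hx => hout x fun hxU => by
    linarith [G.Ueps_norm hxU]) (fun x => hA1 _) hhol' hpq
  rw [setIntegral_eq_integral_of_forall_compl_eq_zero (fun x hx => by rw [hout x hx, mul_zero])]
  refine hmain.trans ?_
  gcongr
  linarith

end
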